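/- arXiv:1008.0916 — 5 statements merged into one kernel-verified Lean document; each statement's English description precedes it below -/
import Mathlib

section
/- There exists a homotopy through immersions F : ℝ × S² → ℝ³ with F(0,·) equal to the standard inclusion of S² into ℝ³ and whose final map g := F(1,·) is antipodally invariant, i.e., g(−x) = g(x) for all x ∈ S². (The halfway model of the eversion is an immersed sphere that double covers an immersed real projective plane in ℝ³.) -/
open scoped Manifold

noncomputable section

/-- ℝ³ as Euclidean space. -/
abbrev E3 := EuclideanSpace ℝ (Fin 3)

/-- The unit 2-sphere in ℝ³ with its standard smooth manifold structure. -/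
abbrev S2 := Metric.sphere (0 : E3) 1

/-- A smooth immersion of the 2-sphere into ℝ³: an infinitely differentiable map whose
manifold derivative is injective at every point. -/
def IsSmoothImmersion (f : S2 → E3) : Prop :=
  ContMDiff (𝓡 2) 𝓘(ℝ, E3) (⊤ : ℕ∞) f ∧
    ∀ x : S2, Function.Injective (mfderiv (𝓡 2) 𝓘(ℝ, E3) f x)

/-- A homotopy through immersions (regular homotopy) from `f` to `g`: a smooth map
`F : ℝ × S² → ℝ³` with `F (0, ·) = f`, `F (1, ·) = g`, and `F (t, ·)` a smooth
immersion for every `t`. -/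
def IsRegularHomotopy (F : ℝ × S2 → E3) (f g : S2 → E3) : Prop :=
  ContMDiff ((𝓘(ℝ, ℝ)).prod (𝓡 2)) 𝓘(ℝ, E3) (⊤ : ℕ∞) F ∧
    (∀ x, F (0, x) = f x) ∧ (∀ x, F (1, x) = g x) ∧
    ∀ t : ℝ, IsSmoothImmersion fun x => F (t, x)

/-- The antipodal map of the 2-sphere. -/
def antipodal (x : S2) : S2 := -x

/-- If the curve described by `h₁`, `h₂`, `h₃` in direction and radius form is stationary, then so
are `X / r ^ 2`, `Y / r ^ 2` and `Z / r ^ 3`. -/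
theorem ratio_stationary_of_stationary {X Y q r Z : ℝ → ℝ} {X' Y' q' r' Z' ξ : ℝ}
    (hX : HasDerivAt X X' 0) (hY : HasDerivAt Y Y' 0) (hq : HasDerivAt q q' 0)
    (hr : HasDerivAt r r' 0) (hZ : HasDerivAt Z Z' 0)
    (hXY : ∀ τ, X τ ^ 2 + Y τ ^ 2 = q τ * r τ) (hξ : 0 ≤ ξ) (hr0 : 0 < r 0) (hq0 : 0 ≤ q 0)
    (hD0 : 0 < ξ * r 0 ^ 3 + q 0)
    (h₁ : HasDerivAt (fun τ => 2 * Real.exp (Z τ / (ξ * r τ ^ 3 + q τ)) *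
      (ξ * r τ ^ 3 + q τ) ^ (-(1 / 3) : ℝ) * X τ /
        (r τ + ((ξ * r τ ^ 3 + q τ) ^ (-(1 / 3) : ℝ)) ^ 2 * q τ)) 0 0)
    (h₂ : HasDerivAt (fun τ => 2 * Real.exp (Z τ / (ξ * r τ ^ 3 + q τ)) *
      (ξ * r τ ^ 3 + q τ) ^ (-(1 / 3) : ℝ) * Y τ /
        (r τ + ((ξ * r τ ^ 3 + q τ) ^ (-(1 / 3) : ℝ)) ^ 2 * q τ)) 0 0)
    (h₃ : HasDerivAt (fun τ => Real.exp (Z τ / (ξ * r τ ^ 3 + q τ)) *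
      (r τ - ((ξ * r τ ^ 3 + q τ) ^ (-(1 / 3) : ℝ)) ^ 2 * q τ) /
        (r τ + ((ξ * r τ ^ 3 + q τ) ^ (-(1 / 3) : ℝ)) ^ 2 * q τ)) 0 0) :
    X' * r 0 = 2 * X 0 * r' ∧ Y' * r 0 = 2 * Y 0 * r' ∧ Z' * r 0 = 3 * Z 0 * r' := by
  have hD : HasDerivAt (fun τ => ξ * r τ ^ 3 + q τ) (3 * ξ * r 0 ^ 2 * r' + q') 0 := by
    refine (((hr.pow 3).const_mul ξ).add hq).congr_deriv ?_
    push_cast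
    ring
  generalize hDf : (fun τ => ξ * r τ ^ 3 + q τ) = D at hD
  have hDτ : ∀ τ, ξ * r τ ^ 3 + q τ = D τ := fun τ => congrFun hDf τ
  simp only [hDτ] at h₁ h₂ h₃ hD0
  set D' := 3 * ξ * r 0 ^ 2 * r' + q' with hD'
  have hg : HasDerivAt (fun τ => D τ ^ (-(1 / 3) : ℝ))
      (-(1 / 3) * D 0 ^ (-(1 / 3) : ℝ) * D' / D 0) 0 := by
    convert hD.rpow_const (p := -(1 / 3)) (Or.inl hD0.ne') using 1
    rw [Real.rpow_sub_one hD0.ne']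
    ring
  have hg0 : 0 < D 0 ^ (-(1 / 3) : ℝ) := Real.rpow_pos_of_pos hD0 _
  generalize hgf : (fun τ => D τ ^ (-(1 / 3) : ℝ)) = g at hg
  have hgτ : ∀ τ, D τ ^ (-(1 / 3) : ℝ) = g τ := fun τ => congrFun hgf τ
  simp only [hgτ] at h₁ h₂ h₃ hg hg0
  set g' := -(1 / 3) * g 0 * D' / D 0 with hg'
  have hgD : 3 * D 0 * g' = -(g 0 * D') := by
    rw [hg']; field_simp
  have ha : HasDerivAt (fun τ => Z τ / D τ) ((Z' * D 0 - Z 0 * D') / D 0 ^ 2) 0 :=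
    hZ.div hD hD0.ne'
  set a' := (Z' * D 0 - Z 0 * D') / D 0 ^ 2 with ha'
  have hE := ha.exp
  have hE0 := Real.exp_pos (Z 0 / D 0)
  have hm := (hg.pow 2).mul hq
  have hN := hr.add hm
  have hN0 : 0 < r 0 + g 0 ^ 2 * q 0 := by positivity
  have e₁ := (((hE.const_mul 2).mul hg).mul hX).div hN hN0.ne' |>.unique h₁
  have e₂ := (((hE.const_mul 2).mul hg).mul hY).div hN hN0.ne' |>.unique h₂
  have e₃ := (hE.mul (hr.sub hm)).div hN hN0.ne' |>.unique h₃
  have hder : 2 * (X 0 * X' + Y 0 * Y') = q' * r 0 + q 0 * r' := by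
    have := ((hX.pow 2).add (hY.pow 2)).unique
      ((hq.mul hr).congr_of_eventuallyEq (Filter.Eventually.of_forall hXY))
    push_cast at this
    linear_combination this
  have hXY0 := hXY 0
  have hDq : D 0 = ξ * r 0 ^ 3 + q 0 := (hDτ 0).symm
  simp only [div_eq_zero_iff, Pi.mul_apply, Pi.add_apply, Pi.pow_apply, Pi.sub_apply, hN0.ne',
    ne_eq, OfNat.ofNat_ne_zero,
    not_false_eq_true, pow_eq_zero_iff, or_false] at e₁ e₂ e₃
  push_cast at e₁ e₂ e₃
  generalize hEv : Real.exp (Z 0 / D 0) = E at *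
  set m' := 2 * g 0 ^ 1 * g' * q 0 + g 0 ^ 2 * q' with hm'
  set N := r 0 + g 0 ^ 2 * q 0 with hNdef
  have ha0 : a' = 0 := by
    have : E * N ^ 3 * a' = 0 := by
      linear_combination (2 * g 0 * X 0) * e₁ + (2 * g 0 * Y 0) * e₂ +
        (r 0 - g 0 ^ 2 * q 0) * e₃ - 4 * E * g 0 * ((a' * g 0 + g') * N - g 0 * (r' + m')) * hXY0 -
        2 * E * g 0 ^ 2 * N * hder
    simpa [hE0.ne', hN0.ne'] using this
  rw [ha0] at e₁ e₂ e₃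
  have hrm : r 0 * m' = r' * (g 0 ^ 2 * q 0) := by
    have : E * (r 0 * m' - r' * (g 0 ^ 2 * q 0)) = 0 := by
      linear_combination -e₃ / 2
    simpa [hE0.ne', sub_eq_zero] using this
  have hqr : q' * r 0 = 3 * q 0 * r' := by
    have h : (g 0 ^ 2 * (3 * ξ * r 0 ^ 3 + q 0)) * (q' * r 0 - 3 * q 0 * r') = 0 := by
      linear_combination 3 * D 0 * hrm - 2 * r 0 * g 0 * q 0 * hgD -
        3 * (r 0 * g 0 ^ 2 * q' - r' * g 0 ^ 2 * q 0) * hDq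
    have hpos : 0 < 3 * ξ * r 0 ^ 3 + q 0 := by nlinarith [pow_pos hr0 3]
    simpa [hg0.ne', hpos.ne', sub_eq_zero] using h
  have hDr : D' * r 0 = 3 * r' * D 0 := by
    linear_combination hqr - 3 * r' * hDq + r 0 * hD'
  have hgr : g' * r 0 = - g 0 * r' := by
    have h : 3 * D 0 * (g' * r 0 + g 0 * r') = 0 := by
      linear_combination r 0 * hgD - g 0 * hDr
    have h' := (mul_eq_zero.1 h).resolve_left (by positivity)
    linear_combination h'
  refine ⟨?_, ?_, ?_⟩
  · have h : (2 * E * g 0 * N) * (X' * r 0 - 2 * X 0 * r') = 0 := by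
      linear_combination r 0 * e₁ - 2 * E * X 0 * N * hgr + 2 * E * g 0 * X 0 * hrm
    simpa [hE0.ne', hg0.ne', hN0.ne', sub_eq_zero] using h
  · have h : (2 * E * g 0 * N) * (Y' * r 0 - 2 * Y 0 * r') = 0 := by
      linear_combination r 0 * e₂ - 2 * E * Y 0 * N * hgr + 2 * E * g 0 * Y 0 * hrm
    simpa [hE0.ne', hg0.ne', hN0.ne', sub_eq_zero] using h
  · rw [ha', div_eq_zero_iff] at ha0
    have h0 := ha0.resolve_right (by positivity)
    have h : D 0 * (Z' * r 0 - 3 * Z 0 * r') = 0 := by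
      linear_combination r 0 * h0 + Z 0 * hDr
    simpa [hD0.ne', sub_eq_zero] using h

/-- The real part of `(x + i y) ^ 3`. -/
def reCube (x y : ℝ) : ℝ := x ^ 3 - 3 * x * y ^ 2

/-- The imaginary part of `(x + i y) ^ 3`. -/
def imCube (x y : ℝ) : ℝ := 3 * x ^ 2 * y - y ^ 3

/-- The real part of the complex factor of the horizontal coordinate. -/
def qRe (P δ b x y : ℝ) : ℝ := (1 - b) * (δ * (x ^ 2 + y ^ 2) + P * imCube x y) + b

/-- The imaginary part of the complex factor of the horizontal coordinate. -/
def qIm (P b x y s : ℝ) : ℝ := (1 - b) * (s + P * reCube x y)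

/-- The squared modulus of the complex factor of the horizontal coordinate. -/
def qSq (P δ b x y s : ℝ) : ℝ := qRe P δ b x y ^ 2 + qIm P b x y s ^ 2

/-- The common denominator; it is positive on the unit sphere when `b ≤ 1`. -/
def den (P δ b x y s : ℝ) : ℝ := (1 - b) * (x ^ 2 + y ^ 2) ^ 3 + qSq P δ b x y s

/-- The numerator of the logarithm of the radius when `c = 0`. -/
def numer (δ κ ε x y s : ℝ) : ℝ :=
  ε * (s * imCube x y - δ * (x ^ 2 + y ^ 2) * reCube x y / 3) - κ * (x ^ 2 + y ^ 2) ^ 2 * s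

/-- The factor making the direction of the surface homogeneous of degree zero. -/
def scale (P δ b x y s : ℝ) : ℝ := den P δ b x y s ^ (-(1 / 3) : ℝ)

/-- The logarithm of the distance of the surface to the origin when `c = 0`. -/
def logRadius (P δ κ ε b c x y s : ℝ) : ℝ :=
  (1 - c) * (numer δ κ ε x y s / den P δ b x y s) - c * s

/-- The denominator of the inverse stereographic projection. -/
def weight (P δ b x y s : ℝ) : ℝ := x ^ 2 + y ^ 2 + scale P δ b x y s ^ 2 * qSq P δ b x y s

/-- The first coordinate of the surface: the exponential of `logRadius` times an inverse
stereographic projection of `q * (x + i y)` for `c = 0`, and `x` for `c = 1`. -/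
def surfX (P δ κ ε b c x y s : ℝ) : ℝ :=
  (1 - c) * (2 * Real.exp (logRadius P δ κ ε b c x y s) * scale P δ b x y s *
    (qRe P δ b x y * x - qIm P b x y s * y) / weight P δ b x y s) + c * x

/-- The second coordinate of the surface, interpolating to `y` at `c = 1`. -/
def surfY (P δ κ ε b c x y s : ℝ) : ℝ :=
  (1 - c) * (2 * Real.exp (logRadius P δ κ ε b c x y s) * scale P δ b x y s *
    (qRe P δ b x y * y + qIm P b x y s * x) / weight P δ b x y s) + c * y

/-- The third coordinate of the surface, interpolating to `s` at `c = 1`. -/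
def surfZ (P δ κ ε b c x y s : ℝ) : ℝ :=
  (1 - c) * (Real.exp (logRadius P δ κ ε b c x y s) *
    (x ^ 2 + y ^ 2 - scale P δ b x y s ^ 2 * qSq P δ b x y s) / weight P δ b x y s) -
    c * logRadius P δ κ ε b c x y s

section Line

variable {x y s σ β : ℝ}

theorem hasDerivAt_line (a v : ℝ) : HasDerivAt (fun τ : ℝ => a + τ * v) v 0 := by
  simpa using ((hasDerivAt_id (0 : ℝ)).mul_const v).const_add a

theorem hasDerivAt_line_normSq :
    HasDerivAt (fun τ : ℝ => (x + τ * (-σ * s * x - β * y)) ^ 2 +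
      (y + τ * (-σ * s * y + β * x)) ^ 2) (-2 * σ * s * (x ^ 2 + y ^ 2)) 0 := by
  refine (((hasDerivAt_line x _).pow 2).add ((hasDerivAt_line y _).pow 2)).congr_deriv ?_
  push_cast
  ring

theorem hasDerivAt_line_reCube :
    HasDerivAt (fun τ : ℝ => reCube (x + τ * (-σ * s * x - β * y))
      (y + τ * (-σ * s * y + β * x))) (-3 * σ * s * reCube x y - 3 * β * imCube x y) 0 := by
  have hx := hasDerivAt_line x (-σ * s * x - β * y)
  have hy := hasDerivAt_line y (-σ * s * y + β * x)
  refine ((hx.pow 3).sub ((hx.const_mul 3).mul (hy.pow 2))).congr_deriv ?_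
  simp [reCube, imCube]
  ring

theorem hasDerivAt_line_imCube :
    HasDerivAt (fun τ : ℝ => imCube (x + τ * (-σ * s * x - β * y))
      (y + τ * (-σ * s * y + β * x))) (-3 * σ * s * imCube x y + 3 * β * reCube x y) 0 := by
  have hx := hasDerivAt_line x (-σ * s * x - β * y)
  have hy := hasDerivAt_line y (-σ * s * y + β * x)
  refine ((((hx.pow 2).const_mul 3).mul hy).sub (hy.pow 3)).congr_deriv ?_
  simp [reCube, imCube]
  ring

theorem line_equations {P δ κ ε b : ℝ} (hr : 0 < x ^ 2 + y ^ 2) (hb : b ≤ 1)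
    (hD : 0 < den P δ b x y s)
    (h₁ : HasDerivAt (fun τ => surfX P δ κ ε b 0 (x + τ * (-σ * s * x - β * y))
      (y + τ * (-σ * s * y + β * x)) (s + τ * (σ * (x ^ 2 + y ^ 2)))) 0 0)
    (h₂ : HasDerivAt (fun τ => surfY P δ κ ε b 0 (x + τ * (-σ * s * x - β * y))
      (y + τ * (-σ * s * y + β * x)) (s + τ * (σ * (x ^ 2 + y ^ 2)))) 0 0)
    (h₃ : HasDerivAt (fun τ => surfZ P δ κ ε b 0 (x + τ * (-σ * s * x - β * y))
      (y + τ * (-σ * s * y + β * x)) (s + τ * (σ * (x ^ 2 + y ^ 2)))) 0 0) :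
    (1 - b) * (δ * (-2 * σ * s * (x ^ 2 + y ^ 2)) +
        P * (-3 * σ * s * imCube x y + 3 * β * reCube x y)) +
      3 * σ * s * qRe P δ b x y - β * qIm P b x y s = 0 ∧
    (1 - b) * (σ * (x ^ 2 + y ^ 2) + P * (-3 * σ * s * reCube x y - 3 * β * imCube x y)) +
      3 * σ * s * qIm P b x y s + β * qRe P δ b x y = 0 ∧
    ε * ((σ * (x ^ 2 + y ^ 2) + 3 * σ * s ^ 2) * imCube x y + 3 * β * s * reCube x y +
      δ * (x ^ 2 + y ^ 2) * (β * imCube x y - σ * s * reCube x y / 3)) -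
      κ * (σ * (x ^ 2 + y ^ 2) ^ 2 * (x ^ 2 + y ^ 2 + 2 * s ^ 2)) = 0 := by
  simp only [surfX, surfY, surfZ, logRadius, weight, scale, den, sub_zero, one_mul, zero_mul,
    add_zero] at h₁ h₂ h₃
  have hx := hasDerivAt_line x (-σ * s * x - β * y)
  have hy := hasDerivAt_line y (-σ * s * y + β * x)
  have hs := hasDerivAt_line s (σ * (x ^ 2 + y ^ 2))
  have hn := hasDerivAt_line_normSq (x := x) (y := y) (s := s) (σ := σ) (β := β)
  have hC := hasDerivAt_line_reCube (x := x) (y := y) (s := s) (σ := σ) (β := β)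
  have hS := hasDerivAt_line_imCube (x := x) (y := y) (s := s) (σ := σ) (β := β)
  have hR := (((hn.const_mul δ).add (hS.const_mul P)).const_mul (1 - b)).add_const b
  have hI := ((hs.add (hC.const_mul P)).const_mul (1 - b))
  have hq := (hR.pow 2).add (hI.pow 2)
  have hZ := (((hs.mul hS).sub (((hn.const_mul δ).mul hC).div_const 3)).const_mul ε).sub
    (((hn.pow 2).const_mul κ).mul hs)
  obtain ⟨e₁, e₂, e₃⟩ := ratio_stationary_of_stationary ((hR.mul hx).sub (hI.mul hy))
    ((hR.mul hy).add (hI.mul hx)) hq hn hZ (ξ := 1 - b)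
    (fun τ => by simp; ring)
    (by linarith) (by simpa using hr) (by simp; positivity)
    (by simpa [den, qSq, qRe, qIm] using hD) h₁ h₂ h₃
  simp at e₁ e₂ e₃
  have hr2 : (x ^ 2 + y ^ 2) ^ 2 ≠ 0 := by positivity
  refine ⟨mul_left_cancel₀ hr2 ?_, mul_left_cancel₀ hr2 ?_, mul_left_cancel₀ hr.ne' ?_⟩
  · simp only [qRe, qIm]
    linear_combination x * e₁ + y * e₂
  · simp only [qRe, qIm]
    linear_combination x * e₂ - y * e₁
  · linear_combination e₃

end Line

theorem reCube_sq_add_imCube_sq (x y : ℝ) :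
    reCube x y ^ 2 + imCube x y ^ 2 = (x ^ 2 + y ^ 2) ^ 3 := by
  simp only [reCube, imCube]
  ring

theorem abs_le_of_sq_add_sq_eq_cube {C S r : ℝ} (hr : 0 ≤ r) (hr1 : r ≤ 1)
    (h : C ^ 2 + S ^ 2 = r ^ 3) : |C| ≤ r := by
  refine abs_le_of_sq_le_sq ?_ hr
  nlinarith [sq_nonneg S, mul_nonneg (sq_nonneg r) (sub_nonneg.2 hr1)]

theorem determinant_pos_of_eq_zero {δ κ ε s C S r : ℝ} (hr : 0 < r) (hs : r + s ^ 2 = 1)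
    (h : C ^ 2 + S ^ 2 = r ^ 3) (hδ : 0 < δ) (hε : 0 ≤ ε) (hκ : 3 * δ * ε ≤ κ) (hκ0 : 0 < κ) :
    0 < (8 / 3 * ε * s * (δ * r) * C - κ * r ^ 2 * (1 + s ^ 2)) * (-(δ * r)) := by
  have hr1 : r ≤ 1 := by nlinarith
  have hC := abs_le_of_sq_add_sq_eq_cube hr.le hr1 h
  have hs1 : |s| ≤ 1 := abs_le_of_sq_le_sq (by nlinarith) one_pos.le
  have hsC : |s * C| ≤ r := by
    rw [abs_mul]
    nlinarith [abs_nonneg s, abs_nonneg C]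
  have h1 : s * C ≤ r := (abs_le.1 hsC).2
  have h2 : δ * ε * (s * C) ≤ δ * ε * r := mul_le_mul_of_nonneg_left h1 (by positivity)
  have h3 : 8 / 3 * (δ * ε * r) < κ * r * (1 + s ^ 2) := by
    rcases hε.eq_or_lt with rfl | hε
    · simp; positivity
    · nlinarith [mul_pos (mul_pos hδ hε) hr, mul_le_mul_of_nonneg_right hκ hr.le,
        mul_nonneg (mul_pos hκ0 hr).le (sq_nonneg s)]
  have h4 : 0 < δ * r ^ 2 * (κ * r * (1 + s ^ 2) - 8 / 3 * (δ * ε * (s * C))) := by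
    apply mul_pos (by positivity)
    linarith
  linarith

theorem determinant_pos_of_pos {P δ κ s C S r : ℝ} (hr : 0 < r) (hs : r + s ^ 2 = 1)
    (h : C ^ 2 + S ^ 2 = r ^ 3) (hP : 0 < P) (hδ : 0 ≤ δ) (hδ' : δ ≤ 1 / 8) (hκ : 3 * δ ≤ κ)
    (hκ' : κ ≤ 1 / 2) :
    0 < P * (2 * S ^ 2 + 6 * C ^ 2) * (1 + 2 * s ^ 2) +
      (8 / 3 * s * (δ * r) * C - κ * r ^ 2 * (1 + s ^ 2)) * (2 * P * S - δ * r) := by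
  have hκ0 : 0 ≤ κ := by linarith
  have hr1 : r ≤ 1 := by nlinarith
  have hC := abs_le_of_sq_add_sq_eq_cube hr.le hr1 h
  have hS := abs_le_of_sq_add_sq_eq_cube hr.le hr1 (C := S) (S := C) (by linarith)
  have hs1 : |s| ≤ 1 := abs_le_of_sq_le_sq (by nlinarith) one_pos.le
  have h1 : s * C ≤ r := by
    refine (le_abs_self _).trans ?_
    rw [abs_mul]
    nlinarith [abs_nonneg s, abs_nonneg C]
  have hCS : |C * S| ≤ r ^ 3 / 2 := by
    rw [abs_le]
    constructor <;> nlinarith [sq_nonneg (C + S), sq_nonneg (C - S)]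
  have hsCS : -(r ^ 3 / 2) ≤ s * (C * S) := by
    refine neg_le_of_abs_le ?_
    rw [abs_mul]
    nlinarith [abs_nonneg s, abs_nonneg (C * S)]
  have hδr : δ * r ≤ 1 / 8 := by nlinarith
  have t1 : 2 * P * r ^ 3 * (1 + 2 * s ^ 2) ≤ P * (2 * S ^ 2 + 6 * C ^ 2) * (1 + 2 * s ^ 2) := by
    rw [← h]
    apply mul_le_mul_of_nonneg_right _ (by positivity)
    nlinarith [mul_nonneg hP.le (sq_nonneg C)]
  have t2 : κ * r ^ 2 * (1 + s ^ 2) * (2 * P * S) ≤ P * r ^ 3 * (1 + 2 * s ^ 2) := by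
    have a1 : κ * S ≤ 1 / 2 * r :=
      mul_le_mul_of_nonneg hκ' (le_of_abs_le hS) hκ0 hr.le
    have a2 := mul_le_mul_of_nonneg_left a1 (by positivity : 0 ≤ 2 * P * r ^ 2 * (1 + s ^ 2))
    nlinarith [mul_nonneg (mul_pos hP (pow_pos hr 3)).le (sq_nonneg s)]
  have t3 : -(P * r ^ 3 / 3) ≤ 8 / 3 * s * (δ * r) * C * (2 * P * S) := by
    have a1 := mul_le_mul_of_nonneg_left hsCS (by positivity : 0 ≤ 16 / 3 * P * (δ * r))
    have a2 := mul_le_mul_of_nonneg_right hδr (by positivity : 0 ≤ 8 / 3 * P * r ^ 3)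
    nlinarith
  have t4 : 0 ≤ δ * r ^ 2 * (κ * r * (1 + s ^ 2) - 8 / 3 * (δ * (s * C))) := by
    apply mul_nonneg (by positivity)
    nlinarith [mul_le_mul_of_nonneg_left h1 hδ, mul_le_mul_of_nonneg_right hκ hr.le,
      mul_nonneg (mul_nonneg hκ0 hr.le) (sq_nonneg s), mul_nonneg hδ hr.le]
  have t5 : 0 < P * r ^ 3 := by positivity
  have t6 : 0 ≤ P * r ^ 3 * s ^ 2 := by positivity
  nlinarith

/-- Tangent vectors to the sphere at `(x, y, s)` on which the differential of the surface with the
given parameters vanishes are zero. -/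
def IsRegularAt (P δ κ ε b c x y s : ℝ) : Prop :=
  ∀ u v w : ℝ, x * u + y * v + s * w = 0 →
    HasDerivAt (fun τ => surfX P δ κ ε b c (x + τ * u) (y + τ * v) (s + τ * w)) 0 0 →
    HasDerivAt (fun τ => surfY P δ κ ε b c (x + τ * u) (y + τ * v) (s + τ * w)) 0 0 →
    HasDerivAt (fun τ => surfZ P δ κ ε b c (x + τ * u) (y + τ * v) (s + τ * w)) 0 0 →
    u = 0 ∧ v = 0 ∧ w = 0

theorem isRegularAt_of_line {P δ κ ε b c x y s : ℝ} (hr : 0 < x ^ 2 + y ^ 2)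
    (h : ∀ σ β : ℝ,
      HasDerivAt (fun τ => surfX P δ κ ε b c (x + τ * (-σ * s * x - β * y))
        (y + τ * (-σ * s * y + β * x)) (s + τ * (σ * (x ^ 2 + y ^ 2)))) 0 0 →
      HasDerivAt (fun τ => surfY P δ κ ε b c (x + τ * (-σ * s * x - β * y))
        (y + τ * (-σ * s * y + β * x)) (s + τ * (σ * (x ^ 2 + y ^ 2)))) 0 0 →
      HasDerivAt (fun τ => surfZ P δ κ ε b c (x + τ * (-σ * s * x - β * y))
        (y + τ * (-σ * s * y + β * x)) (s + τ * (σ * (x ^ 2 + y ^ 2)))) 0 0 →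
      σ = 0 ∧ β = 0) : IsRegularAt P δ κ ε b c x y s := by
  intro u v w huvw h₁ h₂ h₃
  obtain ⟨σ, hσ⟩ : ∃ σ, σ * (x ^ 2 + y ^ 2) = w := ⟨w / (x ^ 2 + y ^ 2), by field_simp⟩
  obtain ⟨β, hβ⟩ : ∃ β, β * (x ^ 2 + y ^ 2) = x * v - y * u :=
    ⟨(x * v - y * u) / (x ^ 2 + y ^ 2), by field_simp⟩
  have hu : u = -σ * s * x - β * y := by
    apply mul_left_cancel₀ hr.ne'
    linear_combination x * huvw + s * x * hσ + y * hβ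
  have hv : v = -σ * s * y + β * x := by
    apply mul_left_cancel₀ hr.ne'
    linear_combination y * huvw + s * y * hσ - x * hβ
  subst hu hv hσ
  obtain ⟨rfl, rfl⟩ := h σ β h₁ h₂ h₃
  simp

theorem den_pos {P δ b x y s : ℝ} (hxys : x ^ 2 + y ^ 2 + s ^ 2 = 1) (hb : b ≤ 1) :
    0 < den P δ b x y s := by
  have hq : 0 ≤ qSq P δ b x y s := by unfold qSq; positivity
  rcases hb.eq_or_lt with rfl | hb
  · simp [den, qSq, qRe, qIm]
  · rcases (by positivity : 0 ≤ x ^ 2 + y ^ 2).eq_or_lt with hr | hr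
    · have hx : x = 0 := by nlinarith
      have hy : y = 0 := by nlinarith
      have hs : s ^ 2 = 1 := by linarith
      subst hx hy
      have : den P δ b 0 0 s = b ^ 2 + (1 - b) ^ 2 := by
        simp [den, qSq, qRe, qIm, reCube, imCube, mul_pow, hs]
      rw [this]
      nlinarith [sq_nonneg b, mul_pos (sub_pos.2 hb) (sub_pos.2 hb)]
    · have : 0 < (1 - b) * (x ^ 2 + y ^ 2) ^ 3 := mul_pos (by linarith) (by positivity)
      unfold den
      linarith

theorem isRegularAt_of_determinant {P δ κ ε x y s : ℝ} (hxys : x ^ 2 + y ^ 2 + s ^ 2 = 1)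
    (hr : 0 < x ^ 2 + y ^ 2)
    (h : 0 < ε * P * (2 * imCube x y ^ 2 + 6 * reCube x y ^ 2) * (1 + 2 * s ^ 2) +
      (8 / 3 * ε * s * (δ * (x ^ 2 + y ^ 2)) * reCube x y -
        κ * (x ^ 2 + y ^ 2) ^ 2 * (1 + s ^ 2)) * (2 * P * imCube x y - δ * (x ^ 2 + y ^ 2))) :
    IsRegularAt P δ κ ε 0 0 x y s := by
  refine isRegularAt_of_line hr fun σ β h₁ h₂ h₃ => ?_
  obtain ⟨e₁, e₂, e₃⟩ := line_equations hr zero_le_one (den_pos hxys zero_le_one) h₁ h₂ h₃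
  simp only [qRe, qIm] at e₁ e₂
  generalize reCube x y = C at *
  generalize imCube x y = S at *
  have hrs : x ^ 2 + y ^ 2 = 1 - s ^ 2 := by linarith
  rw [hrs] at e₁ e₂ e₃ h
  have hβ : β = 0 := by
    have : β * (ε * P * (2 * S ^ 2 + 6 * C ^ 2) * (1 + 2 * s ^ 2) +
      (8 / 3 * ε * s * (δ * (1 - s ^ 2)) * C -
        κ * (1 - s ^ 2) ^ 2 * (1 + s ^ 2)) * (2 * P * S - δ * (1 - s ^ 2))) = 0 := by
      linear_combination (1 + 2 * s ^ 2) * (e₃ + 3 * ε * C * e₁) +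
        (8 / 3 * ε * s * (δ * (1 - s ^ 2)) * C -
          κ * (1 - s ^ 2) ^ 2 * (1 + s ^ 2) + ε * S * (1 + 2 * s ^ 2)) * (-e₂)
    exact (mul_eq_zero.1 this).resolve_right h.ne'
  subst hβ
  refine ⟨?_, rfl⟩
  have : σ * (1 + 2 * s ^ 2) = 0 := by linear_combination e₂
  exact (mul_eq_zero.1 this).resolve_right (by positivity)

theorem isRegularAt_of_convex {δ κ b x y s : ℝ} (hxys : x ^ 2 + y ^ 2 + s ^ 2 = 1)
    (hr : 0 < x ^ 2 + y ^ 2) (hδ : 0 < δ) (hκ : 0 < κ) (hb : 0 ≤ b) (hb1 : b ≤ 1) :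
    IsRegularAt 0 δ κ 0 b 0 x y s := by
  refine isRegularAt_of_line hr fun σ β h₁ h₂ h₃ => ?_
  obtain ⟨e₁, e₂, e₃⟩ := line_equations hr hb1 (den_pos hxys hb1) h₁ h₂ h₃
  have hσ : σ = 0 := by
    have hpos : 0 < κ * (x ^ 2 + y ^ 2) ^ 2 * (x ^ 2 + y ^ 2 + 2 * s ^ 2) := by positivity
    refine (mul_eq_zero.1 (?_ : σ * _ = 0)).resolve_right hpos.ne'
    linear_combination -e₃
  subst hσ
  refine ⟨rfl, ?_⟩
  have hq : 0 < qRe 0 δ b x y := by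
    have h1 : 0 ≤ (1 - b) * (δ * (x ^ 2 + y ^ 2)) :=
      mul_nonneg (by linarith) (by positivity)
    rcases hb.eq_or_lt with rfl | hb
    · simp only [qRe]; simp; positivity
    · simp only [qRe]; linarith
  refine (mul_eq_zero.1 (?_ : β * _ = 0)).resolve_right hq.ne'
  linear_combination e₂

theorem eq_zero_of_stationary_interpolation {X Y r a : ℝ → ℝ} {X' Y' r' a' c : ℝ}
    (hX : HasDerivAt X X' 0) (hY : HasDerivAt Y Y' 0) (hr : HasDerivAt r r' 0)
    (ha : HasDerivAt a a' 0) (hXY : ∀ τ, X τ ^ 2 + Y τ ^ 2 = r τ) (hr0 : 0 < r 0) (hr1 : r 0 ≤ 1)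
    (hc : 0 ≤ c) (hc1 : c ≤ 1)
    (h₁ : HasDerivAt (fun τ => (1 - c) * (2 * Real.exp (a τ) * X τ / (r τ + 1)) + c * X τ) 0 0)
    (h₂ : HasDerivAt (fun τ => (1 - c) * (2 * Real.exp (a τ) * Y τ / (r τ + 1)) + c * Y τ) 0 0)
    (h₃ : HasDerivAt (fun τ => (1 - c) * (Real.exp (a τ) * (r τ - 1) / (r τ + 1)) - c * a τ) 0 0) :
    X' = 0 ∧ Y' = 0 ∧ r' = 0 ∧ a' = 0 := by
  have hE := ha.exp
  have hN0 : r 0 + 1 ≠ 0 := by positivity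
  have e₁ := (((((hE.const_mul 2).mul hX).div (hr.add_const 1) hN0).const_mul (1 - c)).add
    (hX.const_mul c)).unique h₁
  have e₂ := (((((hE.const_mul 2).mul hY).div (hr.add_const 1) hN0).const_mul (1 - c)).add
    (hY.const_mul c)).unique h₂
  have e₃ := ((((hE.mul (hr.sub_const 1)).div (hr.add_const 1) hN0).const_mul (1 - c)).sub
    (ha.const_mul c)).unique h₃
  have hder : 2 * (X 0 * X' + Y 0 * Y') = r' := by
    have := ((hX.pow 2).add (hY.pow 2)).unique
      (hr.congr_of_eventuallyEq (Filter.Eventually.of_forall hXY))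
    push_cast at this
    linear_combination this
  have hXY0 := hXY 0
  have hE0 := Real.exp_pos (a 0)
  simp only [Pi.mul_apply] at e₁ e₂ e₃
  generalize Real.exp (a 0) = E at *
  generalize X 0 = x at *
  generalize Y 0 = y at *
  generalize r 0 = n at *
  field_simp at e₁ e₂ e₃
  obtain ⟨m, rfl⟩ : ∃ m, c = 1 - m := ⟨1 - c, by ring⟩
  have hm : 0 ≤ m := by linarith
  have f₁ : r' * (m * E * (1 - n) + (1 - m) * (n + 1) ^ 2 / 2) +
      a' * (2 * m * E * n * (n + 1)) = 0 := by
    linear_combination x * e₁ + y * e₂ -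
      (m * E * (n + 1) + (1 - m) * (n + 1) ^ 2 / 2) * hder -
      (2 * m * E * a' * (n + 1) - 2 * m * E * r') * hXY0
  have f₂ : r' * (2 * m * E) = a' * ((n + 1) * (m * E * (1 - n) + (1 - m) * (n + 1))) := by
    linear_combination e₃
  have hpos : 0 < 2 * m * E * n * (n + 1) * (2 * m * E) +
      (m * E * (1 - n) + (1 - m) * (n + 1) ^ 2 / 2) *
        ((n + 1) * (m * E * (1 - n) + (1 - m) * (n + 1))) := by
    have h1n : 0 ≤ 1 - n := by linarith
    rcases hm.eq_or_lt with rfl | hm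
    · simp; positivity
    · positivity
  have ha0 : a' = 0 := by
    refine (mul_eq_zero.1 (?_ : a' * _ = 0)).resolve_right hpos.ne'
    linear_combination (2 * m * E) * f₁ -
      (m * E * (1 - n) + (1 - m) * (n + 1) ^ 2 / 2) * f₂
  have hr' : r' = 0 := by
    refine (mul_eq_zero.1 (?_ : r' * _ = 0)).resolve_right hpos.ne'
    linear_combination (2 * m * E * n * (n + 1)) * f₂ +
      ((n + 1) * (m * E * (1 - n) + (1 - m) * (n + 1))) * f₁
  have hpos' : 0 < (n + 1) * (2 * m * E + (1 - m) * (n + 1)) := by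
    rcases hm.eq_or_lt with rfl | hm <;> positivity
  rw [ha0, hr'] at e₁ e₂
  refine ⟨(mul_eq_zero.1 (?_ : _ * X' = 0)).resolve_left hpos'.ne',
    (mul_eq_zero.1 (?_ : _ * Y' = 0)).resolve_left hpos'.ne', hr', ha0⟩
  · linear_combination e₁
  · linear_combination e₂

theorem isRegularAt_of_interpolation {δ κ c x y s : ℝ} (hxys : x ^ 2 + y ^ 2 + s ^ 2 = 1)
    (hr : 0 < x ^ 2 + y ^ 2) (hκ : 0 < κ) (hc : 0 ≤ c) (hc1 : c ≤ 1) :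
    IsRegularAt 0 δ κ 0 1 c x y s := by
  refine isRegularAt_of_line hr fun σ β h₁ h₂ h₃ => ?_
  simp only [surfX, surfY, surfZ, logRadius, weight, scale, den, numer, qSq, qRe, qIm, sub_self,
    zero_mul, zero_add, one_pow, ne_eq, OfNat.ofNat_ne_zero, not_false_eq_true, zero_pow, add_zero,
    Real.one_rpow, mul_one, one_mul, div_one, zero_sub, sub_zero] at h₁ h₂ h₃
  have hs := hasDerivAt_line s (σ * (x ^ 2 + y ^ 2))
  have hn := hasDerivAt_line_normSq (x := x) (y := y) (s := s) (σ := σ) (β := β)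
  obtain ⟨eX, eY, er, ea⟩ := eq_zero_of_stationary_interpolation
    (hasDerivAt_line x (-σ * s * x - β * y)) (hasDerivAt_line y (-σ * s * y + β * x)) hn
    (((((hn.pow 2).const_mul κ).mul hs).neg.const_mul (1 - c)).sub (hs.const_mul c))
    (fun _ => rfl) (by simpa using hr) (by simp; nlinarith) hc hc1 h₁ h₂ h₃
  have hβ : β * (x ^ 2 + y ^ 2) = 0 := by linear_combination x * eY - y * eX
  have hσs : σ * s = 0 := by
    refine (mul_eq_zero.1 (?_ : _ * (x ^ 2 + y ^ 2) = 0)).resolve_right hr.ne'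
    linear_combination -er / 2
  refine ⟨?_, (mul_eq_zero.1 hβ).resolve_right hr.ne'⟩
  rw [er] at ea
  simp at ea
  have hpos : 0 < (x ^ 2 + y ^ 2) * ((1 - c) * κ * (x ^ 2 + y ^ 2) ^ 2 + c) := by
    have : 0 ≤ 1 - c := by linarith
    rcases hc.eq_or_lt with rfl | hc
    · simp; positivity
    · positivity
  refine (mul_eq_zero.1 (?_ : σ * _ = 0)).resolve_right hpos.ne'
  linear_combination -ea

theorem weight_pos {P δ b x y s : ℝ} (hxys : x ^ 2 + y ^ 2 + s ^ 2 = 1) (hb : b ≤ 1) :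
    0 < weight P δ b x y s := by
  have hD := den_pos (P := P) (δ := δ) hxys hb
  have hq : 0 ≤ qSq P δ b x y s := by unfold qSq; positivity
  have hg : 0 < scale P δ b x y s := Real.rpow_pos_of_pos hD _
  unfold weight
  rcases (by positivity : 0 ≤ x ^ 2 + y ^ 2).eq_or_lt with hr | hr
  · have : 0 < qSq P δ b x y s := by simpa [den, ← hr] using hD
    rw [← hr]
    positivity
  · positivity

/-- The real part of the complex number multiplying `x + i y` in `surfX + i surfY`. -/
def coefRe (P δ κ ε b c x y s : ℝ) : ℝ :=
  (1 - c) * (2 * Real.exp (logRadius P δ κ ε b c x y s) * scale P δ b x y s *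
    qRe P δ b x y / weight P δ b x y s) + c

/-- The imaginary part of the complex number multiplying `x + i y` in `surfX + i surfY`. -/
def coefIm (P δ κ ε b c x y s : ℝ) : ℝ :=
  (1 - c) * (2 * Real.exp (logRadius P δ κ ε b c x y s) * scale P δ b x y s *
    qIm P b x y s / weight P δ b x y s)

theorem surfX_eq (P δ κ ε b c x y s : ℝ) :
    surfX P δ κ ε b c x y s = coefRe P δ κ ε b c x y s * x - coefIm P δ κ ε b c x y s * y := by
  simp only [surfX, coefRe, coefIm]
  ring

theorem surfY_eq (P δ κ ε b c x y s : ℝ) :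
    surfY P δ κ ε b c x y s = coefRe P δ κ ε b c x y s * y + coefIm P δ κ ε b c x y s * x := by
  simp only [surfY, coefRe, coefIm]
  ring

section Smooth

variable {E : Type*} [NormedAddCommGroup E] [NormedSpace ℝ E] {n : WithTop ℕ∞}
  {P δ κ ε b c x y s : E → ℝ} {e : E}

theorem contDiffAt_qRe (hP : ContDiffAt ℝ n P e) (hδ : ContDiffAt ℝ n δ e)
    (hb : ContDiffAt ℝ n b e) (hx : ContDiffAt ℝ n x e) (hy : ContDiffAt ℝ n y e) :
    ContDiffAt ℝ n (fun z => qRe (P z) (δ z) (b z) (x z) (y z)) e := by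
  simp only [qRe, imCube]
  fun_prop

theorem contDiffAt_qIm (hP : ContDiffAt ℝ n P e) (hb : ContDiffAt ℝ n b e)
    (hx : ContDiffAt ℝ n x e) (hy : ContDiffAt ℝ n y e) (hs : ContDiffAt ℝ n s e) :
    ContDiffAt ℝ n (fun z => qIm (P z) (b z) (x z) (y z) (s z)) e := by
  simp only [qIm, reCube]
  fun_prop

theorem contDiffAt_qSq (hP : ContDiffAt ℝ n P e) (hδ : ContDiffAt ℝ n δ e)
    (hb : ContDiffAt ℝ n b e) (hx : ContDiffAt ℝ n x e) (hy : ContDiffAt ℝ n y e)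
    (hs : ContDiffAt ℝ n s e) :
    ContDiffAt ℝ n (fun z => qSq (P z) (δ z) (b z) (x z) (y z) (s z)) e :=
  ((contDiffAt_qRe hP hδ hb hx hy).pow 2).add ((contDiffAt_qIm hP hb hx hy hs).pow 2)

theorem contDiffAt_den (hP : ContDiffAt ℝ n P e) (hδ : ContDiffAt ℝ n δ e)
    (hb : ContDiffAt ℝ n b e) (hx : ContDiffAt ℝ n x e) (hy : ContDiffAt ℝ n y e)
    (hs : ContDiffAt ℝ n s e) :
    ContDiffAt ℝ n (fun z => den (P z) (δ z) (b z) (x z) (y z) (s z)) e := by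
  have := contDiffAt_qSq hP hδ hb hx hy hs
  simp only [den]
  fun_prop

theorem contDiffAt_scale (hP : ContDiffAt ℝ n P e) (hδ : ContDiffAt ℝ n δ e)
    (hb : ContDiffAt ℝ n b e) (hx : ContDiffAt ℝ n x e) (hy : ContDiffAt ℝ n y e)
    (hs : ContDiffAt ℝ n s e) (hxys : x e ^ 2 + y e ^ 2 + s e ^ 2 = 1) (hb1 : b e ≤ 1) :
    ContDiffAt ℝ n (fun z => scale (P z) (δ z) (b z) (x z) (y z) (s z)) e :=
  (contDiffAt_den hP hδ hb hx hy hs).rpow_const_of_ne (den_pos hxys hb1).ne'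

theorem contDiffAt_logRadius (hP : ContDiffAt ℝ n P e) (hδ : ContDiffAt ℝ n δ e)
    (hκ : ContDiffAt ℝ n κ e) (hε : ContDiffAt ℝ n ε e)
    (hb : ContDiffAt ℝ n b e) (hc : ContDiffAt ℝ n c e) (hx : ContDiffAt ℝ n x e)
    (hy : ContDiffAt ℝ n y e) (hs : ContDiffAt ℝ n s e)
    (hxys : x e ^ 2 + y e ^ 2 + s e ^ 2 = 1) (hb1 : b e ≤ 1) :
    ContDiffAt ℝ n
      (fun z => logRadius (P z) (δ z) (κ z) (ε z) (b z) (c z) (x z) (y z) (s z)) e := by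
  have hZ : ContDiffAt ℝ n (fun z => numer (δ z) (κ z) (ε z) (x z) (y z) (s z)) e := by
    simp only [numer, reCube, imCube]
    fun_prop
  exact ((contDiffAt_const.sub hc).mul
    (hZ.div (contDiffAt_den hP hδ hb hx hy hs) (den_pos hxys hb1).ne')).sub (hc.mul hs)

theorem contDiffAt_weight (hP : ContDiffAt ℝ n P e) (hδ : ContDiffAt ℝ n δ e)
    (hb : ContDiffAt ℝ n b e) (hx : ContDiffAt ℝ n x e) (hy : ContDiffAt ℝ n y e)
    (hs : ContDiffAt ℝ n s e) (hxys : x e ^ 2 + y e ^ 2 + s e ^ 2 = 1) (hb1 : b e ≤ 1) :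
    ContDiffAt ℝ n (fun z => weight (P z) (δ z) (b z) (x z) (y z) (s z)) e :=
  ((hx.pow 2).add (hy.pow 2)).add (((contDiffAt_scale hP hδ hb hx hy hs hxys hb1).pow 2).mul
    (contDiffAt_qSq hP hδ hb hx hy hs))

theorem contDiffAt_coefRe (hP : ContDiffAt ℝ n P e) (hδ : ContDiffAt ℝ n δ e)
    (hκ : ContDiffAt ℝ n κ e) (hε : ContDiffAt ℝ n ε e)
    (hb : ContDiffAt ℝ n b e) (hc : ContDiffAt ℝ n c e) (hx : ContDiffAt ℝ n x e)
    (hy : ContDiffAt ℝ n y e) (hs : ContDiffAt ℝ n s e)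
    (hxys : x e ^ 2 + y e ^ 2 + s e ^ 2 = 1) (hb1 : b e ≤ 1) :
    ContDiffAt ℝ n
      (fun z => coefRe (P z) (δ z) (κ z) (ε z) (b z) (c z) (x z) (y z) (s z)) e :=
  ((contDiffAt_const.sub hc).mul ((((contDiffAt_const.mul
    (contDiffAt_logRadius hP hδ hκ hε hb hc hx hy hs hxys hb1).exp).mul
    (contDiffAt_scale hP hδ hb hx hy hs hxys hb1)).mul (contDiffAt_qRe hP hδ hb hx hy)).div
    (contDiffAt_weight hP hδ hb hx hy hs hxys hb1) (weight_pos hxys hb1).ne')).add hc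

theorem contDiffAt_coefIm (hP : ContDiffAt ℝ n P e) (hδ : ContDiffAt ℝ n δ e)
    (hκ : ContDiffAt ℝ n κ e) (hε : ContDiffAt ℝ n ε e)
    (hb : ContDiffAt ℝ n b e) (hc : ContDiffAt ℝ n c e) (hx : ContDiffAt ℝ n x e)
    (hy : ContDiffAt ℝ n y e) (hs : ContDiffAt ℝ n s e)
    (hxys : x e ^ 2 + y e ^ 2 + s e ^ 2 = 1) (hb1 : b e ≤ 1) :
    ContDiffAt ℝ n
      (fun z => coefIm (P z) (δ z) (κ z) (ε z) (b z) (c z) (x z) (y z) (s z)) e :=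
  (contDiffAt_const.sub hc).mul ((((contDiffAt_const.mul
    (contDiffAt_logRadius hP hδ hκ hε hb hc hx hy hs hxys hb1).exp).mul
    (contDiffAt_scale hP hδ hb hx hy hs hxys hb1)).mul (contDiffAt_qIm hP hb hx hy hs)).div
    (contDiffAt_weight hP hδ hb hx hy hs hxys hb1) (weight_pos hxys hb1).ne')

theorem contDiffAt_surfZ (hP : ContDiffAt ℝ n P e) (hδ : ContDiffAt ℝ n δ e)
    (hκ : ContDiffAt ℝ n κ e) (hε : ContDiffAt ℝ n ε e)
    (hb : ContDiffAt ℝ n b e) (hc : ContDiffAt ℝ n c e) (hx : ContDiffAt ℝ n x e)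
    (hy : ContDiffAt ℝ n y e) (hs : ContDiffAt ℝ n s e)
    (hxys : x e ^ 2 + y e ^ 2 + s e ^ 2 = 1) (hb1 : b e ≤ 1) :
    ContDiffAt ℝ n
      (fun z => surfZ (P z) (δ z) (κ z) (ε z) (b z) (c z) (x z) (y z) (s z)) e :=
  have ha := contDiffAt_logRadius hP hδ hκ hε hb hc hx hy hs hxys hb1
  ((contDiffAt_const.sub hc).mul ((ha.exp.mul (((hx.pow 2).add (hy.pow 2)).sub
    (((contDiffAt_scale hP hδ hb hx hy hs hxys hb1).pow 2).mul
      (contDiffAt_qSq hP hδ hb hx hy hs)))).div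
    (contDiffAt_weight hP hδ hb hx hy hs hxys hb1) (weight_pos hxys hb1).ne')).sub (hc.mul ha)

end Smooth

theorem isRegularAt_pole {P δ κ ε b c s : ℝ} (hs : s ^ 2 = 1) (hb : b ≤ 1)
    (hc : c = 0 ∨ (b = 1 ∧ 0 ≤ c ∧ c ≤ 1)) : IsRegularAt P δ κ ε b c 0 0 s := by
  intro u v w huvw h₁ h₂ _
  have hs0 : s ≠ 0 := by rintro rfl; norm_num at hs
  have hw : w = 0 := by simpa [hs0] using huvw
  subst hw
  have hxys : (0 : ℝ) ^ 2 + 0 ^ 2 + s ^ 2 = 1 := by simpa using hs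
  simp only [zero_add, mul_zero, add_zero, surfX_eq, surfY_eq] at h₁ h₂
  have hl (a : ℝ) : HasDerivAt (fun τ : ℝ => τ * a) a 0 := by
    simpa using (hasDerivAt_id (0 : ℝ)).mul_const a
  have hl' (a : ℝ) : ContDiffAt ℝ 1 (fun τ : ℝ => τ * a) 0 := by fun_prop
  have hA := ((contDiffAt_coefRe (n := 1) (P := fun _ => P) (δ := fun _ => δ) (κ := fun _ => κ)
    (ε := fun _ => ε) (b := fun _ => b) (c := fun _ => c) (x := fun τ : ℝ => τ * u)
    (y := fun τ => τ * v) (s := fun _ => s) contDiffAt_const contDiffAt_const contDiffAt_const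
    contDiffAt_const contDiffAt_const contDiffAt_const (hl' u) (hl' v) contDiffAt_const
    (by simpa using hs) hb).differentiableAt one_ne_zero).hasDerivAt
  have hB := ((contDiffAt_coefIm (n := 1) (P := fun _ => P) (δ := fun _ => δ) (κ := fun _ => κ)
    (ε := fun _ => ε) (b := fun _ => b) (c := fun _ => c) (x := fun τ : ℝ => τ * u)
    (y := fun τ => τ * v) (s := fun _ => s) contDiffAt_const contDiffAt_const contDiffAt_const
    contDiffAt_const contDiffAt_const contDiffAt_const (hl' u) (hl' v) contDiffAt_const
    (by simpa using hs) hb).differentiableAt one_ne_zero).hasDerivAt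
  have e₁ := ((hA.mul (hl u)).sub (hB.mul (hl v))).unique h₁
  have e₂ := ((hA.mul (hl v)).add (hB.mul (hl u))).unique h₂
  simp only [zero_mul, mul_zero, zero_add] at e₁ e₂
  have hD := den_pos (P := P) (δ := δ) hxys hb
  have hg : 0 < scale P δ b 0 0 s := Real.rpow_pos_of_pos hD _
  have hN := weight_pos (P := P) (δ := δ) hxys hb
  have hpos : 0 < coefRe P δ κ ε b c 0 0 s ^ 2 + coefIm P δ κ ε b c 0 0 s ^ 2 := by
    rcases hc with rfl | ⟨rfl, hc0, hc1⟩
    · have hq : 0 < qSq P δ b 0 0 s := by simpa [den] using hD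
      have : coefRe P δ κ ε b 0 0 0 s ^ 2 + coefIm P δ κ ε b 0 0 0 s ^ 2 =
          (2 * Real.exp (logRadius P δ κ ε b 0 0 0 s) * scale P δ b 0 0 s /
            weight P δ b 0 0 s) ^ 2 * qSq P δ b 0 0 s := by
        simp only [coefRe, coefIm, qSq]
        ring
      rw [this]
      positivity
    · have : 0 < coefRe P δ κ ε 1 c 0 0 s := by
        have h1 : 0 < 2 * Real.exp (logRadius P δ κ ε 1 c 0 0 s) * scale P δ 1 0 0 s *
            qRe P δ 1 0 0 / weight P δ 1 0 0 s := by
          have : qRe P δ 1 0 0 = 1 := by simp [qRe]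
          rw [this]
          positivity
        unfold coefRe
        rcases hc0.eq_or_lt with rfl | hc0
        · simpa using h1
        · linarith [mul_nonneg (sub_nonneg.2 hc1) h1.le]
      positivity
  refine ⟨(mul_eq_zero.1 (?_ : _ * u = 0)).resolve_left hpos.ne',
    (mul_eq_zero.1 (?_ : _ * v = 0)).resolve_left hpos.ne', rfl⟩
  · linear_combination coefRe P δ κ ε b c 0 0 s * e₁ + coefIm P δ κ ε b c 0 0 s * e₂
  · linear_combination coefRe P δ κ ε b c 0 0 s * e₂ - coefIm P δ κ ε b c 0 0 s * e₁

instance : Fact (Module.finrank ℝ E3 = 2 + 1) := ⟨finrank_euclideanSpace_fin⟩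

theorem contMDiff_coe_S2 {n : WithTop ℕ∞} :
    ContMDiff (𝓡 2) 𝓘(ℝ, E3) n ((↑) : S2 → E3) :=
  contMDiff_coe_sphere

theorem isSmoothImmersion_comp_coe {Φ : E3 → E3}
    (hΦ : ∀ x : S2, ContDiffAt ℝ (⊤ : ℕ∞) Φ x)
    (h : ∀ (x : S2) (v : E3), inner ℝ (x : E3) v = 0 → fderiv ℝ Φ x v = 0 → v = 0) :
    IsSmoothImmersion fun x => Φ x := by
  refine ⟨fun x => (hΦ x).contMDiffAt.comp x (contMDiff_coe_S2 x), fun x => ?_⟩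
  have hcoe : MDifferentiableAt (𝓡 2) 𝓘(ℝ, E3) ((↑) : S2 → E3) x :=
    (contMDiff_coe_S2 (n := 1) x).mdifferentiableAt one_ne_zero
  have hd : DifferentiableAt ℝ Φ x := (hΦ x).differentiableAt (by simp)
  have hcomp : mfderiv (𝓡 2) 𝓘(ℝ, E3) (fun x : S2 => Φ x) x =
      (fderiv ℝ Φ (x : E3)).comp (mfderiv (𝓡 2) 𝓘(ℝ, E3) ((↑) : S2 → E3) x) := by
    rw [← mfderiv_eq_fderiv]
    exact mfderiv_comp x hd.mdifferentiableAt hcoe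
  rw [hcomp]
  refine (injective_iff_map_eq_zero _).2 fun v hv => ?_
  refine (injective_iff_map_eq_zero _).1 (injective_mvfderiv_subtypeVal_sphere x) v (h x _ ?_ hv)
  have hmem : mfderiv (𝓡 2) 𝓘(ℝ, E3) ((↑) : S2 → E3) x v ∈ (Submodule.span ℝ {(x : E3)})ᗮ := by
    rw [← range_mvfderiv_subtypeVal (n := 2) x]
    exact ⟨v, rfl⟩
  exact Submodule.mem_orthogonal_singleton_iff_inner_right.1 hmem

theorem contMDiff_comp_prod_coe {Ψ : ℝ × E3 → E3}
    (hΨ : ∀ q : ℝ × S2, ContDiffAt ℝ (⊤ : ℕ∞) Ψ (q.1, (q.2 : E3))) :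
    ContMDiff ((𝓘(ℝ, ℝ)).prod (𝓡 2)) 𝓘(ℝ, E3) (⊤ : ℕ∞) fun q : ℝ × S2 => Ψ (q.1, (q.2 : E3)) :=
  fun q => (hΨ q).contMDiffAt.comp q
    (contMDiff_fst.prodMk_space (contMDiff_coe_S2.comp contMDiff_snd) q)

/-- The surface with the given parameters, as a map of ℝ³. -/
def surface (P δ κ ε b c : ℝ) (p : E3) : E3 :=
  !₂[surfX P δ κ ε b c (p 0) (p 1) (p 2), surfY P δ κ ε b c (p 0) (p 1) (p 2),
    surfZ P δ κ ε b c (p 0) (p 1) (p 2)]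

theorem sphere_coord (x : S2) : (x : E3) 0 ^ 2 + (x : E3) 1 ^ 2 + (x : E3) 2 ^ 2 = 1 := by
  have h := EuclideanSpace.real_norm_sq_eq (x : E3)
  rw [norm_eq_of_mem_sphere x, Fin.sum_univ_three] at h
  linarith

theorem contDiffAt_surface {E : Type*} [NormedAddCommGroup E] [NormedSpace ℝ E] {n : WithTop ℕ∞}
    {P δ κ ε b c : E → ℝ} {p : E → E3} {e : E} (hP : ContDiffAt ℝ n P e)
    (hδ : ContDiffAt ℝ n δ e) (hκ : ContDiffAt ℝ n κ e) (hε : ContDiffAt ℝ n ε e)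
    (hb : ContDiffAt ℝ n b e) (hc : ContDiffAt ℝ n c e) (hp : ContDiffAt ℝ n p e)
    (hpe : p e 0 ^ 2 + p e 1 ^ 2 + p e 2 ^ 2 = 1) (hb1 : b e ≤ 1) :
    ContDiffAt ℝ n (fun z => surface (P z) (δ z) (κ z) (ε z) (b z) (c z) (p z)) e := by
  have hi := contDiffAt_euclidean.1 hp
  have hA := contDiffAt_coefRe hP hδ hκ hε hb hc (hi 0) (hi 1) (hi 2) hpe hb1
  have hB := contDiffAt_coefIm hP hδ hκ hε hb hc (hi 0) (hi 1) (hi 2) hpe hb1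
  refine contDiffAt_euclidean.2 fun i => ?_
  fin_cases i
  · simpa [surface, surfX_eq] using (hA.mul (hi 0)).sub (hB.mul (hi 1))
  · simpa [surface, surfY_eq] using (hA.mul (hi 1)).add (hB.mul (hi 0))
  · simpa [surface] using contDiffAt_surfZ hP hδ hκ hε hb hc (hi 0) (hi 1) (hi 2) hpe hb1

theorem isSmoothImmersion_surface {P δ κ ε b c : ℝ} (hb : b ≤ 1)
    (h : ∀ x : S2, IsRegularAt P δ κ ε b c ((x : E3) 0) ((x : E3) 1) ((x : E3) 2)) :
    IsSmoothImmersion fun x => surface P δ κ ε b c x := by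
  have hsmooth (x : S2) : ContDiffAt ℝ (⊤ : ℕ∞) (surface P δ κ ε b c) x :=
    contDiffAt_surface contDiffAt_const contDiffAt_const contDiffAt_const contDiffAt_const
      contDiffAt_const contDiffAt_const contDiffAt_id (sphere_coord x) hb
  refine isSmoothImmersion_comp_coe hsmooth fun x v hxv hv => ?_
  have hline : HasDerivAt (fun τ : ℝ => (x : E3) + τ • v) v 0 := by
    simpa using ((hasDerivAt_id (0 : ℝ)).smul_const v).const_add (x : E3)
  have hd : HasFDerivAt (surface P δ κ ε b c) (fderiv ℝ (surface P δ κ ε b c) x)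
      ((x : E3) + (0 : ℝ) • v) := by
    simpa using ((hsmooth x).differentiableAt (by simp)).hasFDerivAt
  have hcomp := hd.comp_hasDerivAt (0 : ℝ) hline
  rw [hv] at hcomp
  have hi (i : Fin 3) : HasDerivAt (fun τ : ℝ => surface P δ κ ε b c ((x : E3) + τ • v) i) 0 0 := by
    exact ((EuclideanSpace.proj (𝕜 := ℝ) i).hasFDerivAt.comp_hasDerivAt (0 : ℝ) hcomp).congr_deriv
      (map_zero _)
  have hxv' : (x : E3) 0 * v 0 + (x : E3) 1 * v 1 + (x : E3) 2 * v 2 = 0 := by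
    rw [← hxv, PiLp.inner_apply, Fin.sum_univ_three]
    simp [mul_comm]
  obtain ⟨h0, h1, h2⟩ := h x (v 0) (v 1) (v 2) hxv' (by simpa [surface] using hi 0)
    (by simpa [surface] using hi 1) (by simpa [surface] using hi 2)
  ext i
  fin_cases i <;> assumption

/-- The smooth step that rises from `0` to `1` on the interval `[k / 4, (k + 1) / 4]`. -/
def step (k t : ℝ) : ℝ := Real.smoothTransition (4 * t - k)

theorem contDiff_step (k : ℝ) : ContDiff ℝ (⊤ : ℕ∞) (step k) :=
  Real.smoothTransition.contDiff.comp (by fun_prop)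

/-- The homotopy from the inclusion of the sphere to a double cover of Boy's surface. -/
def boyHomotopy (t : ℝ) (p : E3) : E3 :=
  surface (step 3 t) ((1 - step 3 t) / 8) ((1 - step 3 t) / 2) (step 2 t) (1 - step 1 t)
    (1 - step 0 t) p

theorem isRegularAt_boyHomotopy (t : ℝ) {x y s : ℝ} (hxys : x ^ 2 + y ^ 2 + s ^ 2 = 1) :
    IsRegularAt (step 3 t) ((1 - step 3 t) / 8) ((1 - step 3 t) / 2) (step 2 t) (1 - step 1 t)
      (1 - step 0 t) x y s := by
  have h0 (k : ℝ) : 0 ≤ step k t := Real.smoothTransition.nonneg _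
  have h1 (k : ℝ) : step k t ≤ 1 := Real.smoothTransition.le_one _
  have hzero {k : ℝ} (h : 4 * t ≤ k) : step k t = 0 :=
    Real.smoothTransition.zero_of_nonpos (by linarith)
  have hone {k : ℝ} (h : k + 1 ≤ 4 * t) : step k t = 1 :=
    Real.smoothTransition.one_of_one_le (by linarith)
  rcases (by positivity : 0 ≤ x ^ 2 + y ^ 2).eq_or_lt with hr | hr
  · have hx : x = 0 := by nlinarith
    have hy : y = 0 := by nlinarith
    subst hx hy
    refine isRegularAt_pole (by linarith) (by linarith [h0 1]) ?_
    rcases le_total (4 * t) 1 with ht | ht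
    · right
      rw [hzero ht]
      exact ⟨by norm_num, by linarith [h1 0], by linarith [h0 0]⟩
    · left
      rw [hone (by linarith), sub_self]
  have hrs : x ^ 2 + y ^ 2 + s ^ 2 = 1 := hxys
  have hCS := reCube_sq_add_imCube_sq x y
  rcases le_total (4 * t) 1 with ht | ht
  · rw [hzero (k := 3) (by linarith), hzero (k := 2) (by linarith), hzero ht, sub_zero]
    exact isRegularAt_of_interpolation hxys hr (by norm_num) (by linarith [h1 0])
      (by linarith [h0 0])
  rw [hone (k := 0) (by linarith), sub_self]
  rcases le_total (4 * t) 2 with ht' | ht'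
  · rw [hzero (k := 3) (by linarith), hzero ht']
    exact isRegularAt_of_convex hxys hr (by norm_num) (by norm_num) (by linarith [h1 1])
      (by linarith [h0 1])
  rw [hone (k := 1) (by linarith), sub_self]
  apply isRegularAt_of_determinant hxys hr
  rcases le_or_gt (4 * t) 3 with ht'' | ht''
  · rw [hzero ht'']
    have := determinant_pos_of_eq_zero (δ := 1 / 8) (κ := 1 / 2) hr hrs hCS (by norm_num) (h0 2)
      (by linarith [h1 2]) (by norm_num)
    norm_num at this ⊢
    linarith
  · rw [hone (k := 2) (by linarith)]
    have hP : 0 < step 3 t := Real.smoothTransition.pos_of_pos (by linarith)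
    have := determinant_pos_of_pos (δ := (1 - step 3 t) / 8) (κ := (1 - step 3 t) / 2) hr hrs hCS
      hP (by linarith [h1 3]) (by linarith) (by linarith [h1 3]) (by linarith)
    simpa only [one_mul, mul_one] using this

theorem contMDiff_boyHomotopy :
    ContMDiff ((𝓘(ℝ, ℝ)).prod (𝓡 2)) 𝓘(ℝ, E3) (⊤ : ℕ∞)
      fun q : ℝ × S2 => boyHomotopy q.1 q.2 := by
  refine contMDiff_comp_prod_coe (Ψ := fun z : ℝ × E3 => boyHomotopy z.1 z.2) fun q => ?_
  have hstep (k : ℝ) : ContDiffAt ℝ (⊤ : ℕ∞) (fun z : ℝ × E3 => step k z.1) (q.1, (q.2 : E3)) :=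
    ((contDiff_step k).comp contDiff_fst).contDiffAt
  exact contDiffAt_surface (hstep 3) ((contDiffAt_const.sub (hstep 3)).div_const 8)
    ((contDiffAt_const.sub (hstep 3)).div_const 2) (hstep 2) (contDiffAt_const.sub (hstep 1))
    (contDiffAt_const.sub (hstep 0)) contDiffAt_snd (sphere_coord q.2)
    (sub_le_self _ (Real.smoothTransition.nonneg _))

theorem boyHomotopy_zero (p : E3) : boyHomotopy 0 p = p := by
  have hstep {k : ℝ} (hk : 0 ≤ k) : step k 0 = 0 :=
    Real.smoothTransition.zero_of_nonpos (by linarith)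
  ext i
  fin_cases i <;> simp [boyHomotopy, surface, surfX, surfY, surfZ, logRadius, hstep]

theorem boyHomotopy_one_neg (p : E3) : boyHomotopy 1 (-p) = boyHomotopy 1 p := by
  have hstep {k : ℝ} (hk : k ≤ 3) : step k 1 = 1 :=
    Real.smoothTransition.one_of_one_le (by linarith)
  have hRe : qRe 1 0 0 (-p 0) (-p 1) = -qRe 1 0 0 (p 0) (p 1) := by
    simp only [qRe, imCube]
    ring
  have hIm : qIm 1 0 (-p 0) (-p 1) (-p 2) = -qIm 1 0 (p 0) (p 1) (p 2) := by
    simp only [qIm, reCube]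
    ring
  have hnumer : numer 0 0 1 (-p 0) (-p 1) (-p 2) = numer 0 0 1 (p 0) (p 1) (p 2) := by
    simp only [numer, imCube]
    ring
  simp only [boyHomotopy, hstep le_rfl, hstep (by norm_num : (2 : ℝ) ≤ 3),
    hstep (by norm_num : (1 : ℝ) ≤ 3), hstep (by norm_num : (0 : ℝ) ≤ 3), sub_self, zero_div]
  ext i
  fin_cases i <;>
    simp [surface, surfX, surfY, surfZ, logRadius, weight, scale, den, qSq, hRe, hIm, hnumer,
      -neg_add_rev]

/-- There is a homotopy through immersions starting from the standard inclusion of `S²` into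
ℝ³ whose final map `g` is antipodally invariant: `g (-x) = g x` for all `x` (the halfway
model of the eversion double covers an immersed projective plane). -/
theorem eversion_halfway_model :
    ∃ (F : ℝ × S2 → E3) (g : S2 → E3),
      IsRegularHomotopy F (fun x : S2 => (x : E3)) g ∧
      ∀ x : S2, g (-x) = g x := by
  refine ⟨fun q => boyHomotopy q.1 q.2, fun x => boyHomotopy 1 x,
    ⟨contMDiff_boyHomotopy, fun x => boyHomotopy_zero x, fun _ => rfl, fun t =>
      isSmoothImmersion_surface (sub_le_self _ (Real.smoothTransition.nonneg _)) fun x =>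
        isRegularAt_boyHomotopy t (sphere_coord x)⟩, fun x => ?_⟩
  simpa using boyHomotopy_one_neg x
end
end

section
/- There exists a smooth immersion g : S² → ℝ³ satisfying g(−x) = g(x) for all x ∈ S². (Equivalently, there exists a smoothly immersed real projective plane in ℝ³, presented as an antipodally invariant immersion of the 2-sphere.) -/
open scoped Manifold

noncomputable section

theorem det_eq_zero_of_mulVec_eq_zero {a₁ a₂ a₃ b₁ b₂ b₃ c₁ c₂ c₃ p q r : ℝ}
    (hv : ¬(p = 0 ∧ q = 0 ∧ r = 0)) (ha : a₁ * p + a₂ * q + a₃ * r = 0)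
    (hb : b₁ * p + b₂ * q + b₃ * r = 0) (hc : c₁ * p + c₂ * q + c₃ * r = 0) :
    a₁ * (b₂ * c₃ - b₃ * c₂) - a₂ * (b₁ * c₃ - b₃ * c₁) + a₃ * (b₁ * c₂ - b₂ * c₁) = 0 := by
  by_contra hd
  refine hv ⟨?_, ?_, ?_⟩ <;> refine (mul_eq_zero.mp ?_).resolve_left hd
  · linear_combination (b₂ * c₃ - b₃ * c₂) * ha - (a₂ * c₃ - a₃ * c₂) * hb +
      (a₂ * b₃ - a₃ * b₂) * hc
  · linear_combination -(b₁ * c₃ - b₃ * c₁) * ha + (a₁ * c₃ - a₃ * c₁) * hb -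
      (a₁ * b₃ - a₃ * b₁) * hc
  · linear_combination (b₁ * c₂ - b₂ * c₁) * ha - (a₁ * c₂ - a₂ * c₁) * hb +
      (a₁ * b₂ - a₂ * b₁) * hc

theorem fact_finrank_E3 : Fact (Module.finrank ℝ E3 = 2 + 1) :=
  ⟨finrank_euclideanSpace_fin⟩

/-- The polynomial map `(x, y, z) ↦ (Re h, Im h, k)` where, with `u = x + i y`,
`h = conj u ^ 2 + 4 u z` and `k = 2 z ^ 2 + z Im (u ^ 3)`. -/
def boyMap (v : E3) : E3 :=
  !₂[v 0 ^ 2 - v 1 ^ 2 + 4 * (v 0 * v 2), 4 * (v 1 * v 2) - 2 * (v 0 * v 1),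
    2 * v 2 ^ 2 + v 2 * (3 * (v 0 ^ 2 * v 1) - v 1 ^ 3)]

theorem boyMap_neg (v : E3) : boyMap (-v) = boyMap v := by
  ext i
  fin_cases i
  · simp [boyMap]
  · simp [boyMap]
  · simp [boyMap]
    ring

theorem contDiff_boyMap : ContDiff ℝ (⊤ : ℕ∞) boyMap := by
  rw [contDiff_euclidean]
  intro i
  fin_cases i <;> (simp [boyMap]; fun_prop)

theorem hasFDerivAt_coord (v : E3) (i : Fin 3) :
    HasFDerivAt (fun w : E3 => w i) (EuclideanSpace.proj i : E3 →L[ℝ] ℝ) v :=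
  (EuclideanSpace.proj i : E3 →L[ℝ] ℝ).hasFDerivAt

theorem fderiv_boyMap_apply_coord (v w : E3) (i : Fin 3) :
    fderiv ℝ boyMap v w i = fderiv ℝ (fun u => boyMap u i) v w := by
  have h := (contDiff_boyMap.differentiable (by simp) v).hasFDerivAt
  have hi := (EuclideanSpace.proj i : E3 →L[ℝ] ℝ).hasFDerivAt.comp v h
  exact (congrArg (fun L : E3 →L[ℝ] ℝ => L w) hi.fderiv).symm

theorem fderiv_boyMap_zero (v w : E3) : fderiv ℝ boyMap v w 0 =
    2 * ((v 0 + 2 * v 2) * w 0 + -v 1 * w 1 + 2 * v 0 * w 2) := by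
  have h₀ := hasFDerivAt_coord v 0
  have h₁ := hasFDerivAt_coord v 1
  have h₂ := hasFDerivAt_coord v 2
  rw [fderiv_boyMap_apply_coord]
  have h := ((h₀.pow 2).sub (h₁.pow 2)).add ((h₀.mul h₂).const_mul 4)
  refine (congrArg (fun L : E3 →L[ℝ] ℝ => L w) (HasFDerivAt.fderiv h)).trans ?_
  simp
  ring

theorem fderiv_boyMap_one (v w : E3) : fderiv ℝ boyMap v w 1 =
    2 * (-v 1 * w 0 + (2 * v 2 - v 0) * w 1 + 2 * v 1 * w 2) := by
  have h₀ := hasFDerivAt_coord v 0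
  have h₁ := hasFDerivAt_coord v 1
  have h₂ := hasFDerivAt_coord v 2
  rw [fderiv_boyMap_apply_coord]
  have h := ((h₁.mul h₂).const_mul 4).sub ((h₀.mul h₁).const_mul 2)
  refine (congrArg (fun L : E3 →L[ℝ] ℝ => L w) (HasFDerivAt.fderiv h)).trans ?_
  simp
  ring

theorem fderiv_boyMap_two (v w : E3) : fderiv ℝ boyMap v w 2 =
    6 * v 0 * v 1 * v 2 * w 0 + 3 * (v 0 ^ 2 - v 1 ^ 2) * v 2 * w 1 +
      (4 * v 2 + 3 * v 0 ^ 2 * v 1 - v 1 ^ 3) * w 2 := by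
  have h₀ := hasFDerivAt_coord v 0
  have h₁ := hasFDerivAt_coord v 1
  have h₂ := hasFDerivAt_coord v 2
  rw [fderiv_boyMap_apply_coord]
  have h := ((h₂.pow 2).const_mul 2).add
    (h₂.mul ((((h₀.pow 2).mul h₁).const_mul 3).sub (h₁.pow 3)))
  refine (congrArg (fun L : E3 →L[ℝ] ℝ => L w) (HasFDerivAt.fderiv h)).trans ?_
  simp
  ring

/-- The quartic form that controls the critical points of `boyMap` on the sphere is positive. -/
theorem boy_quartic_pos {s t : ℝ} (h : s + t = 1) :
    0 < (4 * t ^ 2 - 9 * t * s + 4 * s ^ 2) * (8 * t + s) ^ 2 +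
      64 * t * (4 * t - s) * (s + t) ^ 2 := by
  obtain rfl : s = 1 - t := by linarith
  nlinarith [sq_nonneg (t * (1 - t)), sq_nonneg (t ^ 2), sq_nonneg ((1 - t) ^ 2),
    sq_nonneg (8 * t ^ 2 - t * (1 - t)), sq_nonneg ((1 - t) ^ 2 - 2 * (t * (1 - t))),
    sq_nonneg (2 * t - 1)]

/-- A vector tangent to the unit sphere at `(x, y, z)` and annihilated by the differential of
`boyMap` vanishes. -/
theorem boy_tangent_eq_zero {x y z p q r : ℝ} (hs : x ^ 2 + y ^ 2 + z ^ 2 = 1)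
    (ht : x * p + y * q + z * r = 0)
    (h₁ : (x + 2 * z) * p + -y * q + 2 * x * r = 0)
    (h₂ : -y * p + (2 * z - x) * q + 2 * y * r = 0)
    (h₃ : 6 * x * y * z * p + 3 * (x ^ 2 - y ^ 2) * z * q +
      (4 * z + 3 * x ^ 2 * y - y ^ 3) * r = 0) :
    p = 0 ∧ q = 0 ∧ r = 0 := by
  by_contra hv
  have d₁₂ := det_eq_zero_of_mulVec_eq_zero hv ht h₁ h₂
  have d₁ := det_eq_zero_of_mulVec_eq_zero hv ht h₁ h₃
  have d₂ := det_eq_zero_of_mulVec_eq_zero hv ht h₂ h₃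
  obtain ⟨S, hS⟩ : ∃ S, S = x ^ 2 + y ^ 2 := ⟨_, rfl⟩
  obtain ⟨C, hC⟩ : ∃ C, C = x ^ 3 - 3 * x * y ^ 2 := ⟨_, rfl⟩
  obtain ⟨D, hD⟩ : ∃ D, D = 3 * x ^ 2 * y - y ^ 3 := ⟨_, rfl⟩
  have hSZ : S + z ^ 2 = 1 := by rw [hS]; exact hs
  have hCD : C ^ 2 + D ^ 2 = S ^ 3 := by rw [hC, hD, hS]; ring
  have hJ : 2 * C = z * (5 * S - 4 * z ^ 2) := by
    rw [hC, hS]; linear_combination d₁₂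
  -- real and imaginary parts of the complex minor, after multiplication by `conj u`
  have hRe : 2 * D * (D * (3 * z ^ 2 - S) - 4 * z * S) +
      3 * z * C * (2 * z * C + 4 * S * (z ^ 2 - S)) = 0 := by
    rw [hC, hD, hS]; linear_combination 2 * (x ^ 2 + y ^ 2) * (x * d₁ + y * d₂)
  have hIm : (4 * z * S - 2 * C) * (D * (3 * z ^ 2 - S) - 4 * z * S) +
      6 * z ^ 2 * C * D = 0 := by
    rw [hC, hD, hS]; linear_combination -2 * (x ^ 2 + y ^ 2) * (x * d₂ - y * d₁)
  have hS₀ : S ≠ 0 := by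
    intro h0
    have hx : x = 0 := by nlinarith [sq_nonneg x, sq_nonneg y]
    have hC₀ : C = 0 := by rw [hC, hx]; ring
    have hz : z ^ 3 = 0 := by rw [h0, hC₀] at hJ; linarith
    have hz₀ : z = 0 := pow_eq_zero_iff (by norm_num) |>.mp hz
    rw [h0, hz₀] at hSZ
    norm_num at hSZ
  obtain ⟨Q, hQ⟩ : ∃ Q, Q = 4 * (z ^ 2) ^ 2 - 9 * z ^ 2 * S + 4 * S ^ 2 := ⟨_, rfl⟩
  have hD₂ : 4 * D ^ 2 = (S - 4 * z ^ 2) * Q := by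
    rw [hQ]; linear_combination 4 * hCD - (2 * C + z * (5 * S - 4 * z ^ 2)) * hJ
  have hE : Q * (8 * z ^ 2 + S) + 16 * D * z = 0 := by
    refine (mul_eq_zero.mp ?_).resolve_left hS₀
    rw [hQ]
    linear_combination -2 * hRe + 4 * (3 * z ^ 2 - S) * hCD +
      (12 * z * S * (z ^ 2 - S) + S * (2 * C + z * (5 * S - 4 * z ^ 2))) * hJ
  have hprod : Q * (Q * (8 * z ^ 2 + S) ^ 2 +
      64 * z ^ 2 * (4 * z ^ 2 - S) * (S + z ^ 2) ^ 2) = 0 := by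
    rw [hSZ]
    linear_combination (Q * (8 * z ^ 2 + S) - 16 * D * z) * hE + 64 * z ^ 2 * hD₂
  have hQ₀ : Q = 0 := by
    refine (mul_eq_zero.mp hprod).resolve_right ?_
    rw [hQ]
    exact (boy_quartic_pos hSZ).ne'
  have hz : z ≠ 0 := by
    intro h0
    rw [hQ₀, h0] at hQ
    have : S ^ 2 = 0 := by linarith
    exact hS₀ (pow_eq_zero_iff (by norm_num) |>.mp this)
  have hD₀ : D = 0 := by
    rw [hQ₀] at hE
    refine (mul_eq_zero.mp ?_).resolve_right hz
    linarith
  have hS₄ : S = 4 * z ^ 2 := by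
    have h : z ^ 2 * S * (S - 4 * z ^ 2) = 0 := by
      rw [hD₀, hJ] at hIm
      linear_combination hIm / 4
    have := (mul_eq_zero.mp h).resolve_left (mul_ne_zero (pow_ne_zero 2 hz) hS₀)
    linarith
  rw [hQ₀, hS₄] at hQ
  have : z ^ 4 = 0 := by linarith
  exact hz (pow_eq_zero_iff (by norm_num) |>.mp this)

theorem injective_mfderiv_boyMap_coe (x : S2) :
    Function.Injective (mfderiv (𝓡 2) 𝓘(ℝ, E3) (fun y : S2 => boyMap y) x) := by
  have := fact_finrank_E3
  have hg : MDifferentiableAt 𝓘(ℝ, E3) 𝓘(ℝ, E3) boyMap (x : E3) :=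
    (contDiff_boyMap.differentiable (by simp) _).mdifferentiableAt
  have hc : MDifferentiableAt (𝓡 2) 𝓘(ℝ, E3) ((↑) : S2 → E3) x :=
    (contMDiff_coe_sphere (m := 1) x).mdifferentiableAt one_ne_zero
  have hcomp := mfderiv_comp x hg hc
  rw [mfderiv_eq_fderiv] at hcomp
  refine (injective_iff_map_eq_zero _).mpr fun v hv => ?_
  refine (injective_iff_map_eq_zero _).mp (injective_mvfderiv_subtypeVal_sphere x) v ?_
  obtain ⟨w, hw⟩ : ∃ w : E3, w = mfderiv (𝓡 2) 𝓘(ℝ, E3) ((↑) : S2 → E3) x v := ⟨_, rfl⟩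
  have hmem : w ∈ (Submodule.span ℝ {(x : E3)})ᗮ := by
    rw [← range_mvfderiv_subtypeVal (n := 2) x, hw]
    exact ⟨v, rfl⟩
  have hker : fderiv ℝ boyMap x w = 0 := by
    rw [hw]
    exact (congrArg (fun L => L v) hcomp).symm.trans hv
  have ht := Submodule.mem_orthogonal_singleton_iff_inner_right.mp hmem
  have hs : (x : E3) 0 ^ 2 + (x : E3) 1 ^ 2 + (x : E3) 2 ^ 2 = 1 := by
    have h := EuclideanSpace.real_norm_sq_eq (x : E3)
    rw [norm_eq_of_mem_sphere x, Fin.sum_univ_three] at h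
    linarith
  rw [PiLp.inner_apply, Fin.sum_univ_three] at ht
  simp only [RCLike.inner_apply, conj_trivial] at ht
  have k₀ := fderiv_boyMap_zero x w
  have k₁ := fderiv_boyMap_one x w
  have k₂ := fderiv_boyMap_two x w
  rw [hker, PiLp.zero_apply] at k₀ k₁ k₂
  obtain ⟨h0, h1, h2⟩ := boy_tangent_eq_zero hs (p := w 0) (q := w 1) (r := w 2)
    (by linarith) (by linarith) (by linarith) (by linarith)
  refine hw.symm.trans ?_
  ext i
  fin_cases i
  exacts [h0, h1, h2]

/-- There exists a smooth immersion `g : S² → ℝ³` with `g (-x) = g x` for all `x`, i.e. a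
smoothly immersed real projective plane in ℝ³ presented as an antipodally invariant
immersion of the 2-sphere. -/
theorem exists_immersed_projective_plane :
    ∃ g : S2 → E3, IsSmoothImmersion g ∧ ∀ x : S2, g (-x) = g x := by
  have := fact_finrank_E3
  exact ⟨fun x => boyMap x,
    ⟨contDiff_boyMap.contMDiff.comp contMDiff_coe_sphere, injective_mfderiv_boyMap_coe⟩,
    fun x => boyMap_neg x⟩
end
end

section
/- There exist a smooth immersion g : S² → ℝ³, a homotopy through immersions from g to g ∘ a (where a is the antipodal map of S²), and a homotopy through immersions from g to an injective smooth immersion e : S² → ℝ³. (The constructed immersed sphere S_θ is regularly homotopic both to an embedded sphere and to itself with orientation reversed.) -/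
open scoped Manifold

noncomputable section

namespace SphereEversion

theorem abs_mul_le_of_le {x y a b : ℝ} (hx : |x| ≤ a) (hy : |y| ≤ b) : |x * y| ≤ a * b := by
  rw [abs_mul]
  exact mul_le_mul hx hy (abs_nonneg _) ((abs_nonneg _).trans hx)

theorem fold_estimate_of_small {s A B Z : ℝ} (hs0 : 0 ≤ s) (hs1 : s ≤ 1)
    (hAB : A ^ 2 + B ^ 2 = (1 - Z ^ 2) ^ 2) (hA : |A| ≤ 1) (hB : |B| ≤ 1)
    (hZs : |Z| ≤ 1 / 50) (hη : |A - 100 * Z| ≤ 1 / 1000) :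
    0 < (1 - s) * (-100 * (1 - Z ^ 2) * B * (2 * s * (1 - Z ^ 2) - B)
        + 200 * Z * (A * (100 - A * Z) + Z * B * (2 * s * (1 - Z ^ 2) - B))
        - 2 * s * (-B * (100 - A * Z) + Z * A * (2 * s * (1 - Z ^ 2) - B)))
      + 100 * s * (1 - Z ^ 2) * (2 * s * (1 - Z ^ 2) - B) := by
  have hB2 := (abs_le.1 hB).2
  have hZsq : Z ^ 2 ≤ 1 / 2500 := by
    rw [← sq_abs]
    exact (pow_le_pow_left₀ (abs_nonneg Z) hZs 2).trans (by norm_num)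
  set T := 2 * s * (1 - Z ^ 2) - B with hT
  have hT3 : |T| ≤ 3 := by
    have h := mul_le_of_le_one_right hs0 (show 1 - Z ^ 2 ≤ 1 by linarith [sq_nonneg Z])
    have h' := mul_nonneg hs0 (show 0 ≤ 1 - Z ^ 2 by linarith)
    rw [abs_le]
    constructor <;> linarith [(abs_le.1 hB).1]
  have hZabs : |Z ^ 2| ≤ 1 / 2500 := by rwa [abs_of_nonneg (sq_nonneg Z)]
  have hsabs : |s| ≤ 1 := abs_le.2 ⟨by linarith, hs1⟩
  have hZ2abs : |2 - Z ^ 2| ≤ 2 := abs_le.2 ⟨by linarith, by linarith [sq_nonneg Z]⟩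
  have b₁ := abs_le.1 (abs_mul_le_of_le (abs_mul_le_of_le hsabs hB) (abs_mul_le_of_le hZabs hZ2abs))
  have b₂ := abs_le.1 (abs_mul_le_of_le hZabs (abs_mul_le_of_le hB hB))
  have b₃ := abs_le.1 (abs_mul_le_of_le hA hη)
  have b₄ := abs_le.1 (abs_mul_le_of_le hZabs (abs_mul_le_of_le hA hA))
  have b₅ := abs_le.1 (abs_mul_le_of_le hZabs (abs_mul_le_of_le hB hT3))
  have b₆ := abs_le.1 (abs_mul_le_of_le hsabs (abs_mul_le_of_le hA (abs_mul_le_of_le hB hZs)))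
  have b₇ := abs_le.1 (abs_mul_le_of_le hsabs (abs_mul_le_of_le hZs (abs_mul_le_of_le hA hT3)))
  have b₈ := abs_le.1 (abs_mul_le_of_le (abs_mul_le_of_le hsabs hsabs) (abs_mul_le_of_le hZabs hZ2abs))
  have b₉ := abs_le.1 (abs_mul_le_of_le hsabs (abs_mul_le_of_le hB hZabs))
  set e := 2 * (s * B * (Z ^ 2 * (2 - Z ^ 2))) - Z ^ 2 * (B * B) - 2 * (A * (A - 100 * Z))
    - 2 * (Z ^ 2 * (A * A)) + 2 * (Z ^ 2 * (B * T)) + s * (A * (B * Z)) * (-1 / 50)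
    - s * (Z * (A * T)) / 50 with he
  have he1 : -(1 / 50) ≤ e := by rw [he]; linarith
  have hmain : 1 / 10 ≤ (1 - s) * (B ^ 2 + 2 * A ^ 2) + s * (2 * s - B) + (1 - s) * e
      - 2 * (s * s * (Z ^ 2 * (2 - Z ^ 2))) + s * (B * Z ^ 2) := by
    have h4 : 99 / 100 ≤ B ^ 2 + 2 * A ^ 2 := by
      have : (1 - 1 / 2500) ^ 2 ≤ (1 - Z ^ 2) ^ 2 := by gcongr
      linarith [sq_nonneg A]
    have h5 : 97 / 100 * (1 - s) ≤ (1 - s) * (B ^ 2 + 2 * A ^ 2 + e) := by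
      rw [mul_comm]
      gcongr
      linarith
    have h6 : 1 / 2 ≤ 1 - s + s * (2 * s - 1) := by linarith [sq_nonneg (s - 1 / 2)]
    have h7 : s * (2 * s - 1) ≤ s * (2 * s - B) := by gcongr
    linarith
  calc (0 : ℝ) < 100 * ((1 - s) * (B ^ 2 + 2 * A ^ 2) + s * (2 * s - B) + (1 - s) * e
      - 2 * (s * s * (Z ^ 2 * (2 - Z ^ 2))) + s * (B * Z ^ 2)) := by linarith
    _ = _ := by rw [he, hT]; ring

theorem fold_estimate {s A B Z : ℝ} (hs0 : 0 ≤ s) (hs1 : s ≤ 1) (hZ : Z ^ 2 ≤ 1)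
    (hAB : A ^ 2 + B ^ 2 = (1 - Z ^ 2) ^ 2)
    (hfold : (A - 100 * Z) * (100 - A * Z)
      + Z * ((2 * s * (1 - Z ^ 2)) ^ 2 - B ^ 2) = 0) :
    0 < (1 - s) * (-100 * (1 - Z ^ 2) * B * (2 * s * (1 - Z ^ 2) - B)
        + 200 * Z * (A * (100 - A * Z) + Z * B * (2 * s * (1 - Z ^ 2) - B))
        - 2 * s * (-B * (100 - A * Z) + Z * A * (2 * s * (1 - Z ^ 2) - B)))
      + 100 * s * (1 - Z ^ 2) * (2 * s * (1 - Z ^ 2) - B) := by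
  have hr1 : (1 - Z ^ 2) ^ 2 ≤ 1 := by nlinarith [sq_nonneg Z]
  have hA : |A| ≤ 1 := abs_le_one_iff_mul_self_le_one.2 (by nlinarith [sq_nonneg B])
  have hB : |B| ≤ 1 := abs_le_one_iff_mul_self_le_one.2 (by nlinarith [sq_nonneg A])
  have hZ1 : |Z| ≤ 1 := abs_le_one_iff_mul_self_le_one.2 (by nlinarith)
  obtain ⟨hA1, hA2⟩ := abs_le.1 hA
  obtain ⟨hB1, hB2⟩ := abs_le.1 hB
  obtain ⟨hZ2, hZ3⟩ := abs_le.1 hZ1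
  have hq : |(2 * s * (1 - Z ^ 2)) ^ 2 - B ^ 2| ≤ 4 := by
    have hs := mul_le_one₀ (show s ^ 2 ≤ 1 by nlinarith) (sq_nonneg (1 - Z ^ 2)) hr1
    rw [abs_le]; constructor <;> nlinarith [sq_nonneg (s * (1 - Z ^ 2))]
  have hAZ : |A * Z| ≤ 1 := by rw [abs_mul]; exact mul_le_one₀ hA (abs_nonneg _) hZ1
  have hd : 99 ≤ 100 - A * Z := by linarith [(abs_le.1 hAZ).2]
  have hη : |A - 100 * Z| * 99 ≤ 4 * |Z| := by
    calc |A - 100 * Z| * 99 ≤ |A - 100 * Z| * |100 - A * Z| := by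
          gcongr; exact hd.trans (le_abs_self _)
      _ = |Z| * |(2 * s * (1 - Z ^ 2)) ^ 2 - B ^ 2| := by
          rw [← abs_mul, ← abs_mul, ← abs_neg]; congr 1; linarith
      _ ≤ 4 * |Z| := by nlinarith [abs_nonneg Z]
  have hZs : |Z| ≤ 1 / 50 := by
    have h3 : |100 * Z| ≤ |A| + |A - 100 * Z| := by
      have := abs_sub A (A - 100 * Z)
      rwa [sub_sub_cancel] at this
    rw [abs_mul, abs_of_pos (by norm_num : (0:ℝ) < 100)] at h3
    linarith
  exact fold_estimate_of_small hs0 hs1 hAB hA hB hZs (by linarith)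

theorem tangent_eq_zero_of_pos {s α β X Y Z v1 v2 v3 r A B dr dA dB W1 W2 dW1 dW2 N dN : ℝ}
    (hs0 : 0 ≤ s) (hs1 : s ≤ 1) (hαβ : α ^ 2 + β ^ 2 = 1) (hx : X ^ 2 + Y ^ 2 + Z ^ 2 = 1)
    (hv : X * v1 + Y * v2 + Z * v3 = 0)
    (hr : r = X ^ 2 + Y ^ 2) (hdr : dr = 2 * (X * v1 + Y * v2))
    (hA : A = α * (X ^ 2 - Y ^ 2) - β * (2 * X * Y))
    (hB : B = β * (X ^ 2 - Y ^ 2) + α * (2 * X * Y))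
    (hdA : dA = α * (2 * X * v1 - 2 * Y * v2) - β * (2 * (X * v2 + Y * v1)))
    (hdB : dB = β * (2 * X * v1 - 2 * Y * v2) + α * (2 * (X * v2 + Y * v1)))
    (hW1 : W1 = 2 * s * r * X - 100 * Z * Y + r * (α * Y + β * X))
    (hW2 : W2 = 2 * s * r * Y + 100 * Z * X + r * (α * X - β * Y))
    (hdW1 : dW1 = 2 * s * (dr * X + r * v1) - 100 * (v3 * Y + Z * v2)
      + (dr * (α * Y + β * X) + r * (α * v2 + β * v1)))
    (hdW2 : dW2 = 2 * s * (dr * Y + r * v2) + 100 * (v3 * X + Z * v1)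
      + (dr * (α * X - β * Y) + r * (α * v1 - β * v2)))
    (hN0 : N ≠ 0)
    (h1 : W1 * dN = N * dW1) (h2 : W2 * dN = N * dW2) (h3 : r * dN = N * dr)
    (hpos : 0 < r)
    (hz : (1 - s) * (100 * (v3 * B + Z * dB) - s * dA) - 100 * s * v3 = 0) :
    v1 = 0 ∧ v2 = 0 ∧ v3 = 0 := by
  have hrZ : r = 1 - Z ^ 2 := by linarith
  have hQ1 : r * dW1 = W1 * dr := mul_left_cancel₀ hN0 (by linear_combination W1 * h3 - r * h1)
  have hQ2 : r * dW2 = W2 * dr := mul_left_cancel₀ hN0 (by linear_combination W2 * h3 - r * h2)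
  have hrne := hpos.ne'
  obtain ⟨a, ha⟩ : ∃ a, a = (X * v2 - Y * v1) / r := ⟨_, rfl⟩
  obtain ⟨b, hb⟩ : ∃ b, b = -v3 / r := ⟨_, rfl⟩
  have ha' : a * r = X * v2 - Y * v1 := by rw [ha]; field_simp
  have hb' : b * r = -v3 := by rw [hb]; field_simp
  have hv3 : v3 = -(b * r) := by linarith
  have hv1 : v1 = -(a * Y) + b * (X * Z) := mul_right_cancel₀ hrne (by
    linear_combination Y * ha' - X * Z * hb' + X * hv + v1 * hr)
  have hv2 : v2 = a * X + b * (Y * Z) := mul_right_cancel₀ hrne (by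
    linear_combination -X * ha' - Y * Z * hb' + Y * hv + v2 * hr)
  have hABr : A ^ 2 + B ^ 2 = r ^ 2 := by
    rw [hA, hB, hr]; linear_combination (X ^ 2 + Y ^ 2) ^ 2 * hαβ
  have hdr' : dr = 2 * Z * b * r := by rw [hdr, hv1, hv2, hr]; ring
  have hdA' : dA = 2 * (-(a * B) + b * Z * A) := by rw [hdA, hA, hB, hv1, hv2]; ring
  have hdB' : dB = 2 * (a * A + b * Z * B) := by rw [hdB, hA, hB, hv1, hv2]; ring
  have hre : a * (A - 100 * Z) + b * Z * (2 * s * r + B) = 0 := by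
    have : r ^ 2 * (a * (A - 100 * Z) + b * Z * (2 * s * r + B)) = 0 := by
      rw [hW1, hdW1, hdr', hv1, hv2, hv3] at hQ1
      rw [hW2, hdW2, hdr', hv1, hv2, hv3] at hQ2
      rw [hA, hB]
      rw [hr] at hQ1 hQ2 ⊢
      linear_combination X * hQ1 + Y * hQ2
    simpa [hrne] using this
  have him : a * (2 * s * r - B) = b * (100 - A * Z) := by
    have : r ^ 2 * (a * (2 * s * r - B) - b * (100 - A * Z)) = 0 := by
      rw [hW1, hdW1, hdr', hv1, hv2, hv3] at hQ1
      rw [hW2, hdW2, hdr', hv1, hv2, hv3] at hQ2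
      rw [hA, hB]
      rw [hr] at hQ1 hQ2 ⊢
      linear_combination X * hQ2 - Y * hQ1 + 100 * b * (X ^ 2 + Y ^ 2) ^ 2 * hx
    exact sub_eq_zero.1 (by simpa [hrne] using this)
  have hZ1 : Z ^ 2 ≤ 1 := by linarith
  have hAZ : 0 < 100 - A * Z := by
    have hr1 : r ^ 2 ≤ 1 := pow_le_one₀ hpos.le (by linarith [sq_nonneg Z])
    linarith [two_mul_le_add_sq A Z, sq_nonneg B]
  have ha0 : a = 0 := by
    by_contra hane
    have hE := fold_estimate (A := A) (B := B) hs0 hs1 hZ1 (by rw [hABr, hrZ]) (by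
      rw [← hrZ]
      apply mul_left_cancel₀ hane
      linear_combination (100 - A * Z) * hre + Z * (2 * s * r + B) * him)
    rw [← hrZ] at hE
    apply hE.ne'
    apply mul_left_cancel₀ hane
    rw [hdA', hdB', hv3] at hz
    linear_combination (100 - A * Z) * hz + ((1 - s) * (-100 * r * B
      + 200 * Z * (Z * B) - 2 * s * (Z * A)) + 100 * s * r) * him
  have hb0 : b = 0 := by
    rw [ha0, zero_mul] at him
    exact (mul_eq_zero.1 him.symm).resolve_right hAZ.ne'
  simp [hv1, hv2, hv3, ha0, hb0]

theorem tangent_eq_zero {s α β X Y Z v1 v2 v3 r A B dr dA dB W1 W2 dW1 dW2 N dN : ℝ}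
    (hs0 : 0 ≤ s) (hs1 : s ≤ 1) (hαβ : α ^ 2 + β ^ 2 = 1) (hx : X ^ 2 + Y ^ 2 + Z ^ 2 = 1)
    (hv : X * v1 + Y * v2 + Z * v3 = 0)
    (hr : r = X ^ 2 + Y ^ 2) (hdr : dr = 2 * (X * v1 + Y * v2))
    (hA : A = α * (X ^ 2 - Y ^ 2) - β * (2 * X * Y))
    (hB : B = β * (X ^ 2 - Y ^ 2) + α * (2 * X * Y))
    (hdA : dA = α * (2 * X * v1 - 2 * Y * v2) - β * (2 * (X * v2 + Y * v1)))
    (hdB : dB = β * (2 * X * v1 - 2 * Y * v2) + α * (2 * (X * v2 + Y * v1)))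
    (hW1 : W1 = 2 * s * r * X - 100 * Z * Y + r * (α * Y + β * X))
    (hW2 : W2 = 2 * s * r * Y + 100 * Z * X + r * (α * X - β * Y))
    (hdW1 : dW1 = 2 * s * (dr * X + r * v1) - 100 * (v3 * Y + Z * v2)
      + (dr * (α * Y + β * X) + r * (α * v2 + β * v1)))
    (hdW2 : dW2 = 2 * s * (dr * Y + r * v2) + 100 * (v3 * X + Z * v1)
      + (dr * (α * X - β * Y) + r * (α * v1 - β * v2)))
    (hN0 : N ≠ 0)
    (h1 : W1 * dN = N * dW1) (h2 : W2 * dN = N * dW2) (h3 : r * dN = N * dr)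
    (hz : (1 - s) * (100 * (v3 * B + Z * dB) - s * dA) - 100 * s * v3 = 0) :
    v1 = 0 ∧ v2 = 0 ∧ v3 = 0 := by
  have hrZ : r = 1 - Z ^ 2 := by linarith
  have hr0 : 0 ≤ r := by rw [hr]; positivity
  rcases hr0.eq_or_lt with h0 | hpos
  · obtain ⟨hX, hY⟩ : X = 0 ∧ Y = 0 := by
      have h := (add_eq_zero_iff_of_nonneg (sq_nonneg X) (sq_nonneg Y)).1 (hr.symm.trans h0.symm)
      exact ⟨pow_eq_zero_iff two_ne_zero |>.1 h.1, pow_eq_zero_iff two_ne_zero |>.1 h.2⟩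
    have hZ0 : Z ≠ 0 := by rintro rfl; simp [hX, hY] at hx
    have hr' : r = 0 := h0.symm
    subst hX hY
    have hdr0 : dr = 0 := by rw [hdr]; ring
    simp only [hr', hdr0, mul_zero, zero_mul, add_zero, sub_zero, zero_add, zero_sub]
      at hW1 hW2 hdW1 hdW2 hv
    rw [hW1, zero_mul, hdW1] at h1
    rw [hW2, zero_mul, hdW2] at h2
    simp only [zero_eq_mul, neg_eq_zero, hN0, hZ0, mul_eq_zero, false_or, OfNat.ofNat_ne_zero]
      at h1 h2 hv
    exact ⟨h2, h1, hv⟩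
  · exact tangent_eq_zero_of_pos hs0 hs1 hαβ hx hv hr hdr hA hB hdA hdB hW1 hW2 hdW1 hdW2 hN0
      h1 h2 h3 hpos hz


/-- The squared distance of `x` from the vertical axis. -/
def radiusSq (x : E3) : ℝ := x 0 ^ 2 + x 1 ^ 2

/-- The real part of `(α + i β) (x₀ + i x₁) ^ 2`. -/
def saddleRe (α β : ℝ) (x : E3) : ℝ := α * (x 0 ^ 2 - x 1 ^ 2) - β * (2 * x 0 * x 1)

/-- The imaginary part of `(α + i β) (x₀ + i x₁) ^ 2`. -/
def saddleIm (α β : ℝ) (x : E3) : ℝ := β * (x 0 ^ 2 - x 1 ^ 2) + α * (2 * x 0 * x 1)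

/-- With `ζ = x₀ + i x₁`, the real part of
`(2 s |ζ|² + 100 i x₂) ζ + i |ζ|² (α - i β) conj ζ`. -/
def planeRe (s α β : ℝ) (x : E3) : ℝ :=
  2 * s * radiusSq x * x 0 - 100 * x 2 * x 1 + radiusSq x * (α * x 1 + β * x 0)

/-- With `ζ = x₀ + i x₁`, the imaginary part of
`(2 s |ζ|² + 100 i x₂) ζ + i |ζ|² (α - i β) conj ζ`. -/
def planeIm (s α β : ℝ) (x : E3) : ℝ :=
  2 * s * radiusSq x * x 1 + 100 * x 2 * x 0 + radiusSq x * (α * x 0 - β * x 1)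

/-- The quotient of `planeRe ^ 2 + planeIm ^ 2` by `radiusSq`. -/
def planeQuot (s α β : ℝ) (x : E3) : ℝ :=
  (100 * x 2) ^ 2 + ((2 * s) ^ 2 + 1) * radiusSq x ^ 2 + 200 * x 2 * saddleRe α β x
    + 4 * s * radiusSq x * saddleIm α β x

/-- The distance of the image of `x` from the origin. -/
def radialHeight (s α β : ℝ) (x : E3) : ℝ :=
  1000 + ((1 - s) * (100 * (x 2 * saddleIm α β x) - s * saddleRe α β x) - 100 * s * x 2)

/-- The numerators of the inverse stereographic projection of
`(planeRe + i planeIm) / radiusSq`. -/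
def dirNum (s α β : ℝ) (x : E3) : Fin 3 → ℝ :=
  ![2 * planeRe s α β x, 2 * planeIm s α β x, planeQuot s α β x - radiusSq x]

/-- The denominator of the inverse stereographic projection of
`(planeRe + i planeIm) / radiusSq`. -/
def dirDen (s α β : ℝ) (x : E3) : ℝ := planeQuot s α β x + radiusSq x

/-- The half-way model (`s = 0`) of a sphere eversion, rotated by the unit complex number
`α + i β`, and its deformation to an embedded sphere (`s = 1`). -/
def sphereMap (s α β : ℝ) (x : E3) : E3 :=
  WithLp.toLp 2 fun i => radialHeight s α β x * dirNum s α β x i / dirDen s α β x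

variable {s α β : ℝ} {x : E3}

theorem sphereMap_apply (i : Fin 3) :
    sphereMap s α β x i = radialHeight s α β x * dirNum s α β x i / dirDen s α β x := rfl

theorem radiusSq_mul_planeQuot (h : α ^ 2 + β ^ 2 = 1) :
    radiusSq x * planeQuot s α β x = planeRe s α β x ^ 2 + planeIm s α β x ^ 2 := by
  simp only [planeQuot, planeRe, planeIm, saddleRe, saddleIm, radiusSq]
  linear_combination -(x 0 ^ 2 + x 1 ^ 2) ^ 3 * h

theorem sum_dirNum_sq (h : α ^ 2 + β ^ 2 = 1) :
    dirNum s α β x 0 ^ 2 + dirNum s α β x 1 ^ 2 + dirNum s α β x 2 ^ 2 = dirDen s α β x ^ 2 := by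
  simp only [dirNum, dirDen, Matrix.cons_val]
  linear_combination -4 * radiusSq_mul_planeQuot (s := s) (x := x) h

theorem sq_add_sq_add_sq_of_mem (hx : x ∈ Metric.sphere (0 : E3) 1) :
    x 0 ^ 2 + x 1 ^ 2 + x 2 ^ 2 = 1 := by
  have h := EuclideanSpace.real_norm_sq_eq x
  rw [mem_sphere_zero_iff_norm.1 hx, Fin.sum_univ_three] at h
  linarith

theorem radiusSq_eq_zero_iff : radiusSq x = 0 ↔ x 0 = 0 ∧ x 1 = 0 := by
  rw [radiusSq, add_eq_zero_iff_of_nonneg (sq_nonneg _) (sq_nonneg _)]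
  simp

theorem radiusSq_nonneg : 0 ≤ radiusSq x := by
  unfold radiusSq
  positivity

theorem dirDen_pos (h : α ^ 2 + β ^ 2 = 1) (hx : x ∈ Metric.sphere (0 : E3) 1) :
    0 < dirDen s α β x := by
  have hx' := sq_add_sq_add_sq_of_mem hx
  rcases (radiusSq_nonneg (x := x)).eq_or_lt with h0 | hpos
  · obtain ⟨h1, h2⟩ := radiusSq_eq_zero_iff.1 h0.symm
    rw [h1, h2] at hx'
    simp only [dirDen, planeQuot, ← h0, saddleRe, h1, h2]
    linarith
  · have hV : 0 ≤ planeQuot s α β x := by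
      refine nonneg_of_mul_nonneg_right ?_ hpos
      rw [radiusSq_mul_planeQuot h]
      positivity
    exact add_pos_of_nonneg_of_pos hV hpos

theorem saddleRe_sq_add_saddleIm_sq (h : α ^ 2 + β ^ 2 = 1) :
    saddleRe α β x ^ 2 + saddleIm α β x ^ 2 = radiusSq x ^ 2 := by
  simp only [saddleRe, saddleIm, radiusSq]
  linear_combination (x 0 ^ 2 + x 1 ^ 2) ^ 2 * h

theorem radialHeight_pos (hs0 : 0 ≤ s) (hs1 : s ≤ 1) (h : α ^ 2 + β ^ 2 = 1)
    (hx : x ∈ Metric.sphere (0 : E3) 1) : 0 < radialHeight s α β x := by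
  have hx' := sq_add_sq_add_sq_of_mem hx
  have hr : radiusSq x ^ 2 ≤ 1 :=
    pow_le_one₀ radiusSq_nonneg (by rw [radiusSq]; linarith [sq_nonneg (x 2)])
  have hAB := saddleRe_sq_add_saddleIm_sq (x := x) h
  have hA : |saddleRe α β x| ≤ 1 :=
    (sq_le_one_iff_abs_le_one _).1 (by linarith [sq_nonneg (saddleIm α β x)])
  have hB : |saddleIm α β x| ≤ 1 :=
    (sq_le_one_iff_abs_le_one _).1 (by linarith [sq_nonneg (saddleRe α β x)])
  have hZ : |x 2| ≤ 1 :=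
    (sq_le_one_iff_abs_le_one _).1 (by linarith [sq_nonneg (x 0), sq_nonneg (x 1)])
  have hs : |s| ≤ 1 := abs_le.2 ⟨by linarith, hs1⟩
  have hs' : |1 - s| ≤ 1 := abs_le.2 ⟨by linarith, by linarith⟩
  have h1 := abs_le.1 (abs_mul_le_of_le hs' (abs_mul_le_of_le hZ hB))
  have h2 := abs_le.1 (abs_mul_le_of_le hs' (abs_mul_le_of_le hs hA))
  have h3 := abs_le.1 (abs_mul_le_of_le hs hZ)
  unfold radialHeight
  linarith

theorem norm_sphereMap_sq (h : α ^ 2 + β ^ 2 = 1) (hx : x ∈ Metric.sphere (0 : E3) 1) :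
    ‖sphereMap s α β x‖ ^ 2 = radialHeight s α β x ^ 2 := by
  have hN := (dirDen_pos (s := s) h hx).ne'
  rw [EuclideanSpace.real_norm_sq_eq, Fin.sum_univ_three]
  simp only [sphereMap_apply, div_pow, mul_pow]
  rw [← add_div, ← add_div, ← mul_add, ← mul_add, sum_dirNum_sq h]
  field_simp

section Smooth

variable {G : Type*} [NormedAddCommGroup G] [NormedSpace ℝ G] {s α β : G → ℝ} {x : G → E3}
  {n : WithTop ℕ∞}

theorem contDiff_radialHeight (hs : ContDiff ℝ n s) (hα : ContDiff ℝ n α) (hβ : ContDiff ℝ n β)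
    (hx : ContDiff ℝ n x) : ContDiff ℝ n fun g => radialHeight (s g) (α g) (β g) (x g) := by
  have hx' := contDiff_euclidean.1 hx
  unfold radialHeight saddleRe saddleIm
  fun_prop

theorem contDiff_dirDen (hs : ContDiff ℝ n s) (hα : ContDiff ℝ n α) (hβ : ContDiff ℝ n β)
    (hx : ContDiff ℝ n x) : ContDiff ℝ n fun g => dirDen (s g) (α g) (β g) (x g) := by
  have hx' := contDiff_euclidean.1 hx
  unfold dirDen planeQuot radiusSq saddleRe saddleIm
  fun_prop

theorem contDiff_dirNum (hs : ContDiff ℝ n s) (hα : ContDiff ℝ n α) (hβ : ContDiff ℝ n β)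
    (hx : ContDiff ℝ n x) (i : Fin 3) :
    ContDiff ℝ n fun g => dirNum (s g) (α g) (β g) (x g) i := by
  have hx' := contDiff_euclidean.1 hx
  fin_cases i <;> simp only [dirNum, Fin.zero_eta, Fin.mk_one, Fin.reduceFinMk, Matrix.cons_val,
    planeRe, planeIm, planeQuot, radiusSq, saddleRe, saddleIm] <;> fun_prop

theorem contDiffAt_sphereMap (hs : ContDiff ℝ n s) (hα : ContDiff ℝ n α) (hβ : ContDiff ℝ n β)
    (hx : ContDiff ℝ n x) {g : G} (h : α g ^ 2 + β g ^ 2 = 1)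
    (hg : x g ∈ Metric.sphere (0 : E3) 1) :
    ContDiffAt ℝ n (fun g => sphereMap (s g) (α g) (β g) (x g)) g := by
  refine contDiffAt_euclidean.2 fun i => ?_
  exact ((contDiff_radialHeight hs hα hβ hx).contDiffAt.mul
    (contDiff_dirNum hs hα hβ hx i).contDiffAt).div (contDiff_dirDen hs hα hβ hx).contDiffAt
    (dirDen_pos h hg).ne'

end Smooth

theorem contDiffAt_sphereMap_const (h : α ^ 2 + β ^ 2 = 1) (hx : x ∈ Metric.sphere (0 : E3) 1) :
    ContDiffAt ℝ (⊤ : ℕ∞) (sphereMap s α β) x :=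
  contDiffAt_sphereMap contDiff_const contDiff_const contDiff_const contDiff_id h hx

theorem hasDerivAt_div_eq_zero {R p N : ℝ → ℝ} {dR dp dN t : ℝ} (hR : HasDerivAt R dR t)
    (hp : HasDerivAt p dp t) (hN : HasDerivAt N dN t) (hN0 : N t ≠ 0)
    (h : HasDerivAt (fun τ => R τ * p τ / N τ) 0 t) :
    R t * p t * dN = N t * (dR * p t + R t * dp) := by
  have := h.unique ((hR.mul hp).div hN hN0)
  simp only [Pi.mul_apply] at this
  field_simp at this
  linarith

theorem radial_and_direction_stationary {R N dR dN p₀ p₁ p₂ dp₀ dp₁ dp₂ : ℝ} (hR : R ≠ 0)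
    (hN : N ≠ 0) (hp : p₀ ^ 2 + p₁ ^ 2 + p₂ ^ 2 = N ^ 2)
    (hdp : p₀ * dp₀ + p₁ * dp₁ + p₂ * dp₂ = N * dN)
    (h₀ : R * p₀ * dN = N * (dR * p₀ + R * dp₀)) (h₁ : R * p₁ * dN = N * (dR * p₁ + R * dp₁))
    (h₂ : R * p₂ * dN = N * (dR * p₂ + R * dp₂)) :
    dR = 0 ∧ p₀ * dN = N * dp₀ ∧ p₁ * dN = N * dp₁ ∧ p₂ * dN = N * dp₂ := by
  have hdR : dR = 0 := by
    refine mul_left_cancel₀ (pow_ne_zero 3 hN) ?_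
    linear_combination -p₀ * h₀ - p₁ * h₁ - p₂ * h₂ + (R * dN - N * dR) * hp - N * R * hdp
  subst hdR
  refine ⟨rfl, ?_, ?_, ?_⟩ <;> apply mul_left_cancel₀ hR
  · linear_combination h₀
  · linear_combination h₁
  · linear_combination h₂

theorem eq_zero_of_fderiv_sphereMap_eq_zero (hs0 : 0 ≤ s) (hs1 : s ≤ 1) (h : α ^ 2 + β ^ 2 = 1)
    (hx : x ∈ Metric.sphere (0 : E3) 1) {v : E3} (hxv : inner ℝ x v = 0)
    (hv : fderiv ℝ (sphereMap s α β) x v = 0) : v = 0 := by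
  have hN0 := (dirDen_pos (s := s) h hx).ne'
  have hR0 := (radialHeight_pos hs0 hs1 h hx).ne'
  set γ : ℝ → E3 := fun τ => x + τ • v with hγ
  have hγ0 : γ 0 = x := by simp [hγ]
  have hγd : HasDerivAt γ v 0 := by
    simpa [hγ] using ((hasDerivAt_id (0 : ℝ)).smul_const v).const_add x
  have hcoord : ∀ i, HasDerivAt (fun τ => γ τ i) (v i) 0 := fun i =>
    (EuclideanSpace.proj (𝕜 := ℝ) i).hasFDerivAt.comp_hasDerivAt (0 : ℝ) hγd
  have hX := hcoord 0
  have hY := hcoord 1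
  have hZ := hcoord 2
  have hf : ∀ i, HasDerivAt (fun τ => radialHeight s α β (γ τ) * dirNum s α β (γ τ) i
      / dirDen s α β (γ τ)) 0 0 := fun i => by
    have hd : HasFDerivAt (sphereMap s α β) (fderiv ℝ (sphereMap s α β) x) (γ 0) := by
      rw [hγ0]
      exact ((contDiffAt_sphereMap_const h hx).differentiableAt (by simp)).hasFDerivAt
    have := (EuclideanSpace.proj (𝕜 := ℝ) i).hasFDerivAt.comp_hasDerivAt (0 : ℝ)
      (hd.comp_hasDerivAt (0 : ℝ) hγd)
    rw [hv, map_zero] at this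
    exact this
  have hr : HasDerivAt (fun τ => radiusSq (γ τ)) (2 * (x 0 * v 0 + x 1 * v 1)) 0 := by
    refine ((hX.pow 2).add (hY.pow 2)).congr_deriv ?_
    rw [hγ0]; ring
  have hA : HasDerivAt (fun τ => saddleRe α β (γ τ))
      (α * (2 * x 0 * v 0 - 2 * x 1 * v 1) - β * (2 * (x 0 * v 1 + x 1 * v 0))) 0 := by
    refine ((((hX.pow 2).sub (hY.pow 2)).const_mul α).sub
      (((hX.const_mul 2).mul hY).const_mul β)).congr_deriv ?_
    rw [hγ0]; ring
  have hB : HasDerivAt (fun τ => saddleIm α β (γ τ))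
      (β * (2 * x 0 * v 0 - 2 * x 1 * v 1) + α * (2 * (x 0 * v 1 + x 1 * v 0))) 0 := by
    refine ((((hX.pow 2).sub (hY.pow 2)).const_mul β).add
      (((hX.const_mul 2).mul hY).const_mul α)).congr_deriv ?_
    rw [hγ0]; ring
  have hW1 : HasDerivAt (fun τ => planeRe s α β (γ τ)) _ 0 :=
    (((hr.const_mul (2 * s)).mul hX).sub ((hZ.const_mul 100).mul hY)).add
      (hr.mul ((hY.const_mul α).add (hX.const_mul β)))
  have hW2 : HasDerivAt (fun τ => planeIm s α β (γ τ)) _ 0 :=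
    (((hr.const_mul (2 * s)).mul hY).add ((hZ.const_mul 100).mul hX)).add
      (hr.mul ((hX.const_mul α).sub (hY.const_mul β)))
  obtain ⟨dV, hV⟩ : ∃ d, HasDerivAt (fun τ => planeQuot s α β (γ τ)) d 0 :=
    ⟨_, ((((hZ.const_mul 100).pow 2).add ((hr.pow 2).const_mul ((2 * s) ^ 2 + 1))).add
      ((hZ.const_mul 200).mul hA)).add ((hr.const_mul (4 * s)).mul hB)⟩
  have hR : HasDerivAt (fun τ => radialHeight s α β (γ τ)) _ 0 :=
    (((((hZ.mul hB).const_mul 100).sub (hA.const_mul s)).const_mul (1 - s)).sub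
      (hZ.const_mul (100 * s))).const_add 1000
  have hN : HasDerivAt (fun τ => dirDen s α β (γ τ)) _ 0 := hV.add hr
  have hp0 : HasDerivAt (fun τ => dirNum s α β (γ τ) 0) _ 0 := hW1.const_mul 2
  have hp1 : HasDerivAt (fun τ => dirNum s α β (γ τ) 1) _ 0 := hW2.const_mul 2
  have hp2 : HasDerivAt (fun τ => dirNum s α β (γ τ) 2) _ 0 := hV.sub hr
  have hsum := ((((hp0.pow 2).add (hp1.pow 2)).add (hp2.pow 2)).congr_of_eventuallyEq
    (Filter.Eventually.of_forall fun τ => (sum_dirNum_sq h).symm)).unique (hN.pow 2)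
  have e0 := hasDerivAt_div_eq_zero hR hp0 hN (by rwa [hγ0]) (hf 0)
  have e1 := hasDerivAt_div_eq_zero hR hp1 hN (by rwa [hγ0]) (hf 1)
  have e2 := hasDerivAt_div_eq_zero hR hp2 hN (by rwa [hγ0]) (hf 2)
  simp only [hγ0] at e0 e1 e2 hsum
  obtain ⟨hdR, q0, q1, q2⟩ := radial_and_direction_stationary hR0 hN0 (sum_dirNum_sq h)
    (by linear_combination hsum / 2) e0 e1 e2
  have hx' := sq_add_sq_add_sq_of_mem hx
  have hxv' : x 0 * v 0 + x 1 * v 1 + x 2 * v 2 = 0 := by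
    rw [PiLp.inner_apply, Fin.sum_univ_three] at hxv
    simp only [RCLike.inner_apply, conj_trivial] at hxv
    linarith
  simp only [dirNum, Matrix.cons_val] at q0 q1 q2
  obtain ⟨h0, h1, h2⟩ := tangent_eq_zero (A := saddleRe α β x) (B := saddleIm α β x)
    (W1 := planeRe s α β x) (W2 := planeIm s α β x) (r := radiusSq x)
    (dN := dV + 2 * (x 0 * v 0 + x 1 * v 1))
    hs0 hs1 h hx' hxv' rfl rfl rfl rfl rfl rfl rfl rfl rfl rfl hN0
    (by linear_combination q0 / 2) (by linear_combination q1 / 2)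
    (by
      simp only [dirDen] at q2 ⊢
      linear_combination -q2 / 2) (by linear_combination hdR)
  ext i
  fin_cases i
  exacts [h0, h1, h2]

instance fact_finrank_E3 : Fact (Module.finrank ℝ E3 = 2 + 1) := ⟨finrank_euclideanSpace_fin⟩

theorem isSmoothImmersion_comp_coe {f : E3 → E3}
    (hf : ∀ x ∈ Metric.sphere (0 : E3) 1, ContDiffAt ℝ (⊤ : ℕ∞) f x)
    (h : ∀ x ∈ Metric.sphere (0 : E3) 1, ∀ v : E3, inner ℝ x v = 0 →
      fderiv ℝ f x v = 0 → v = 0) :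
    IsSmoothImmersion fun x : S2 => f x := by
  refine ⟨fun x => (hf x x.2).contMDiffAt.comp x (contMDiff_coe_sphere x), fun x => ?_⟩
  have hcoe : MDifferentiableAt (𝓡 2) 𝓘(ℝ, E3) ((↑) : S2 → E3) x :=
    (contMDiff_coe_sphere (m := 1) x).mdifferentiableAt one_ne_zero
  have hfx : MDifferentiableAt 𝓘(ℝ, E3) 𝓘(ℝ, E3) f (x : E3) :=
    ((hf x x.2).differentiableAt (by simp)).mdifferentiableAt
  have hcomp := mfderiv_comp x hfx hcoe
  rw [mfderiv_eq_fderiv] at hcomp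
  change Function.Injective (mfderiv (𝓡 2) 𝓘(ℝ, E3) (f ∘ ((↑) : S2 → E3)) x)
  rw [hcomp, injective_iff_map_eq_zero]
  intro v hv
  have hmem : mvfderiv (𝓡 2) ((↑) : S2 → E3) x v ∈ (Submodule.span ℝ {(x : E3)})ᗮ := by
    rw [← range_mvfderiv_subtypeVal (n := 2) x]
    exact ⟨v, rfl⟩
  have h0 := h x x.2 _ (Submodule.mem_orthogonal_singleton_iff_inner_right.1 hmem) hv
  exact injective_mvfderiv_subtypeVal_sphere x (h0.trans (map_zero _).symm)

theorem isSmoothImmersion_sphereMap (hs0 : 0 ≤ s) (hs1 : s ≤ 1) (h : α ^ 2 + β ^ 2 = 1) :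
    IsSmoothImmersion fun x : S2 => sphereMap s α β x :=
  isSmoothImmersion_comp_coe (fun _ hx => contDiffAt_sphereMap_const h hx)
    fun _ hx _ => eq_zero_of_fderiv_sphereMap_eq_zero hs0 hs1 h hx

theorem isRegularHomotopy_sphereMap {s α β : ℝ → ℝ} (hs : ContDiff ℝ (⊤ : ℕ∞) s)
    (hα : ContDiff ℝ (⊤ : ℕ∞) α) (hβ : ContDiff ℝ (⊤ : ℕ∞) β) (hs0 : ∀ t, 0 ≤ s t)
    (hs1 : ∀ t, s t ≤ 1) (h : ∀ t, α t ^ 2 + β t ^ 2 = 1) :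
    IsRegularHomotopy (fun p : ℝ × S2 => sphereMap (s p.1) (α p.1) (β p.1) p.2)
      (fun x => sphereMap (s 0) (α 0) (β 0) x) (fun x => sphereMap (s 1) (α 1) (β 1) x) := by
  refine ⟨fun p => ?_, fun _ => rfl, fun _ => rfl,
    fun t => isSmoothImmersion_sphereMap (s := s t) (α := α t) (β := β t) (hs0 t) (hs1 t) (h t)⟩
  have hincl : ContMDiff (𝓘(ℝ, ℝ).prod (𝓡 2)) 𝓘(ℝ, ℝ × E3) (⊤ : ℕ∞)
      fun p : ℝ × S2 => (p.1, (p.2 : E3)) :=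
    contMDiff_fst.prodMk_space (contMDiff_coe_sphere.comp contMDiff_snd)
  have hΦ : ContDiffAt ℝ (⊤ : ℕ∞) (fun q : ℝ × E3 => sphereMap (s q.1) (α q.1) (β q.1) q.2)
      (p.1, (p.2 : E3)) :=
    contDiffAt_sphereMap (hs.comp contDiff_fst) (hα.comp contDiff_fst) (hβ.comp contDiff_fst)
      contDiff_snd (h p.1) p.2.2
  exact ContMDiffAt.comp (f := fun p : ℝ × S2 => (p.1, (p.2 : E3)))
    (g := fun q : ℝ × E3 => sphereMap (s q.1) (α q.1) (β q.1) q.2) p hΦ.contMDiffAt (hincl p)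

theorem sphereMap_zero_neg (α β : ℝ) (x : E3) :
    sphereMap 0 α β (-x) = sphereMap 0 (-α) (-β) x := by
  ext i
  fin_cases i <;>
    simp [sphereMap_apply, dirNum, dirDen, radialHeight, planeRe, planeIm, planeQuot, radiusSq,
      saddleRe, saddleIm] <;> ring

theorem sphereMap_one_injOn : Set.InjOn (sphereMap 1 1 0) (Metric.sphere (0 : E3) 1) := by
  intro x hx y hy hxy
  have hu : (1 : ℝ) ^ 2 + (0 : ℝ) ^ 2 = 1 := by norm_num
  have hx' := sq_add_sq_add_sq_of_mem hx
  have hy' := sq_add_sq_add_sq_of_mem hy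
  have hNx := dirDen_pos (s := 1) hu hx
  have hNy := dirDen_pos (s := 1) hu hy
  have hRx := radialHeight_pos zero_le_one le_rfl hu hx
  have hRy := radialHeight_pos zero_le_one le_rfl hu hy
  have hR : radialHeight 1 1 0 x = radialHeight 1 1 0 y := by
    rw [← sq_eq_sq₀ hRx.le hRy.le, ← norm_sphereMap_sq hu hx, ← norm_sphereMap_sq hu hy, hxy]
  have hZ : x 2 = y 2 := by
    simp only [radialHeight] at hR
    linarith
  have hr : radiusSq x = radiusSq y := by
    simp only [radiusSq]
    rw [hZ] at hx'
    linarith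
  have hp : ∀ i, dirNum 1 1 0 x i * dirDen 1 1 0 y = dirNum 1 1 0 y i * dirDen 1 1 0 x := by
    intro i
    have := congrArg (fun z : E3 => z i) hxy
    simp only [sphereMap_apply] at this
    rw [hR, mul_div_assoc, mul_div_assoc] at this
    exact (div_eq_div_iff hNx.ne' hNy.ne').1 (mul_left_cancel₀ hRy.ne' this)
  have h0 := hp 0
  have h1 := hp 1
  have h2 := hp 2
  simp only [dirNum, Matrix.cons_val] at h0 h1 h2
  have hrN : radiusSq y * dirDen 1 1 0 y = radiusSq y * dirDen 1 1 0 x := by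
    simp only [dirDen, hr] at h2 ⊢
    linarith
  rcases (radiusSq_nonneg (x := y)).eq_or_lt with hry | hry
  · obtain ⟨hy0, hy1⟩ := radiusSq_eq_zero_iff.1 hry.symm
    obtain ⟨hx0, hx1⟩ := radiusSq_eq_zero_iff.1 (hr.trans hry.symm)
    ext i
    fin_cases i
    exacts [hx0.trans hy0.symm, hx1.trans hy1.symm, hZ]
  · have hN := mul_left_cancel₀ hry.ne' hrN
    rw [hN] at h0 h1
    have hW1 : planeRe 1 1 0 x = planeRe 1 1 0 y := by
      have := mul_right_cancel₀ hNx.ne' h0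
      linarith
    have hW2 : planeIm 1 1 0 x = planeIm 1 1 0 y := by
      have := mul_right_cancel₀ hNx.ne' h1
      linarith
    simp only [planeRe, planeIm, hr, hZ] at hW1 hW2
    set r := radiusSq y
    have hdet : 3 * r ^ 2 + (100 * y 2) ^ 2 ≠ 0 := by positivity
    have hX : x 0 = y 0 := mul_left_cancel₀ hdet (by
      linear_combination 2 * r * hW1 - (r - 100 * y 2) * hW2)
    have hY : x 1 = y 1 := mul_left_cancel₀ hdet (by
      linear_combination 2 * r * hW2 - (r + 100 * y 2) * hW1)
    ext i
    fin_cases i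
    exacts [hX, hY, hZ]

end SphereEversion

open SphereEversion in
/-- There exists a smooth immersion `g : S² → ℝ³` which is regularly homotopic both to
itself with orientation reversed (to `g ∘ a`, `a` the antipodal map) and to an embedded
sphere (an injective smooth immersion `e`). -/
theorem exists_evertible_immersed_sphere :
    ∃ (g e : S2 → E3) (F₁ F₂ : ℝ × S2 → E3),
      IsSmoothImmersion g ∧
      IsRegularHomotopy F₁ g (g ∘ antipodal) ∧
      IsSmoothImmersion e ∧ Function.Injective e ∧
      IsRegularHomotopy F₂ g e := by
  have hrot := isRegularHomotopy_sphereMap (s := fun _ => 0) (α := fun t => Real.cos (Real.pi * t))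
    (β := fun t => Real.sin (Real.pi * t)) contDiff_const
    (Real.contDiff_cos.comp (contDiff_const.mul contDiff_id))
    (Real.contDiff_sin.comp (contDiff_const.mul contDiff_id))
    (fun _ => le_rfl) (fun _ => zero_le_one) fun t => Real.cos_sq_add_sin_sq _
  have hembed := isRegularHomotopy_sphereMap (α := fun _ => 1) (β := fun _ => 0)
    Real.smoothTransition.contDiff contDiff_const contDiff_const Real.smoothTransition.nonneg
    Real.smoothTransition.le_one fun t => by norm_num
  refine ⟨fun x => sphereMap 0 1 0 x, fun x => sphereMap 1 1 0 x,
    fun p => sphereMap 0 (Real.cos (Real.pi * p.1)) (Real.sin (Real.pi * p.1)) p.2,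
    fun p => sphereMap (Real.smoothTransition p.1) 1 0 p.2,
    isSmoothImmersion_sphereMap le_rfl zero_le_one (by norm_num), ?_,
    isSmoothImmersion_sphereMap zero_le_one le_rfl (by norm_num),
    fun x y hxy => Subtype.ext (sphereMap_one_injOn x.2 y.2 hxy), ?_⟩
  · convert hrot using 1
    · simp
    · funext x
      simp [antipodal, sphereMap_zero_neg]
  · simpa using hembed
end
end

section
/- Let G : EuclideanSpace ℝ (Fin 3) → EuclideanSpace ℝ (Fin 3) be an infinitely differentiable map whose derivative fderiv ℝ G x is injective at every point x of the closed unit ball. Then there exists ε > 0 such that for every t with 0 < t ≤ ε, the map x ↦ G(t • x) restricted to the unit sphere S² is an injective smooth immersion (a smooth embedding). (The restriction of an immersion of a ball to sufficiently small concentric spheres is embedded.) -/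
open scoped Manifold

noncomputable section

/-- If `G : ℝ³ → ℝ³` is smooth with `fderiv ℝ G x` injective at every point of the closed
unit ball, then for all sufficiently small `t > 0` the map `x ↦ G (t • x)` restricted to
the unit sphere is an injective smooth immersion (a smooth embedding): the restriction of
an immersion of a ball to sufficiently small concentric spheres is embedded. -/
theorem small_concentric_spheres_embedded
    (G : E3 → E3) (hG : ContDiff ℝ (⊤ : ℕ∞) G)
    (hG_inj : ∀ x ∈ Metric.closedBall (0 : E3) 1, Function.Injective (fderiv ℝ G x)) :
    ∃ ε > (0 : ℝ), ∀ t : ℝ, 0 < t → t ≤ ε →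
      IsSmoothImmersion (fun x : S2 => G (t • (x : E3))) ∧
      Function.Injective (fun x : S2 => G (t • (x : E3))) := by
  have : Fact (Module.finrank ℝ E3 = 2 + 1) := ⟨finrank_euclideanSpace_fin⟩
  have h0 : Function.Injective (fderiv ℝ G 0) := hG_inj 0 (by simp)
  let e : E3 ≃L[ℝ] E3 :=
    (LinearEquiv.ofInjectiveEndo (fderiv ℝ G 0 : E3 →ₗ[ℝ] E3) h0).toContinuousLinearEquiv
  have he : (e : E3 →L[ℝ] E3) = fderiv ℝ G 0 := by ext x; rfl
  have hstrict : HasStrictFDerivAt G (e : E3 →L[ℝ] E3) 0 := by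
    rw [he]
    exact hG.contDiffAt.hasStrictFDerivAt (by simp)
  obtain ⟨δ, hδ, hball⟩ := Metric.mem_nhds_iff.mp <|
    (hstrict.toOpenPartialHomeomorph G).open_source.mem_nhds
      hstrict.mem_toOpenPartialHomeomorph_source
  have hinj : Set.InjOn G (Metric.ball 0 δ) :=
    (hstrict.toOpenPartialHomeomorph G).injOn.mono hball
  refine ⟨min (δ / 2) 1, by positivity, fun t ht hle => ⟨⟨?_, fun x => ?_⟩, fun x y hxy => ?_⟩⟩
  · exact (hG.comp (contDiff_const_smul t)).contMDiff.comp contMDiff_coe_sphere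
  · have hmem : t • (x : E3) ∈ Metric.closedBall (0 : E3) 1 := by
      rw [mem_closedBall_zero_iff, norm_smul, norm_eq_of_mem_sphere x, Real.norm_of_nonneg ht.le,
        mul_one]
      exact hle.trans (min_le_right _ _)
    have hF : HasFDerivAt (fun y : E3 => G (t • y))
        ((fderiv ℝ G (t • (x : E3))).comp (t • ContinuousLinearMap.id ℝ E3)) (x : E3) :=
      ((hG.differentiable (by simp)) _).hasFDerivAt.comp (x : E3)
        ((hasFDerivAt_id (x : E3)).const_smul t)
    have hcoe : MDifferentiableAt (𝓡 2) 𝓘(ℝ, E3) ((↑) : S2 → E3) x :=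
      (contMDiff_coe_sphere (m := 1)).mdifferentiableAt (by simp)
    have hcomp := hF.hasMFDerivAt.comp x hcoe.hasMFDerivAt
    have hd := hcomp.mfderiv
    change mfderiv (𝓡 2) 𝓘(ℝ, E3) (fun x : S2 => G (t • (x : E3))) x = _ at hd
    rw [hd]
    refine Function.Injective.comp (g := fun v : E3 => fderiv ℝ G (t • (x : E3)) (t • v))
      ((hG_inj _ hmem).comp (smul_right_injective E3 ht.ne')) (injective_mvfderiv_subtypeVal_sphere x)
  · have hmem (z : S2) : t • (z : E3) ∈ Metric.ball (0 : E3) δ := by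
      rw [mem_ball_zero_iff, norm_smul, norm_eq_of_mem_sphere z, Real.norm_of_nonneg ht.le,
        mul_one]
      exact (hle.trans (min_le_left _ _)).trans_lt (half_lt_self hδ)
    exact Subtype.ext (smul_right_injective E3 ht.ne' (hinj (hmem x) (hmem y) hxy))
end
end

section
/- The (2,−1) torus knot K₀ is unknotted: there exists a smooth map H : ℝ × S¹ → ℝ³ such that for every t the map x ↦ H(t,x) is an injective smooth immersion of the circle, H(0,(x,y)) = ((√2 + x)·(x² − y²), (√2 + x)·(2xy), −y) for every (x,y) ∈ S¹ (the (2,−1) torus knot, parametrized so that (cos s, sin s) ↦ ((√2 + cos s)cos 2s, (√2 + cos s)sin 2s, −sin s)), and H(1,(x,y)) = (x, y, 0) (the round unit circle in the xy-plane). -/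
open scoped Manifold

noncomputable section

/-- ℝ² as Euclidean space. -/
abbrev E2 := EuclideanSpace ℝ (Fin 2)

/-- The unit circle in ℝ² with its standard smooth manifold structure. -/
abbrev S1 := Metric.sphere (0 : E2) 1

/-- A smooth immersion of the circle into ℝ³: an infinitely differentiable map whose
manifold derivative is injective at every point. -/
def IsCircleImmersion (f : S1 → E3) : Prop :=
  ContMDiff (𝓡 1) 𝓘(ℝ, E3) (⊤ : ℕ∞) f ∧
    ∀ x : S1, Function.Injective (mfderiv (𝓡 1) 𝓘(ℝ, E3) f x)

/-- The straight-line homotopy from the (2,−1) torus knot (at time `0`) to the round circle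
(at time `1`), as a polynomial map on all of `ℝ × ℝ²`. -/
def torusKnotHomotopy (q : ℝ × E2) : E3 :=
  !₂[(1 - q.1) * ((√2 + q.2 0) * (q.2 0 ^ 2 - q.2 1 ^ 2)) + q.1 * q.2 0,
    (1 - q.1) * ((√2 + q.2 0) * (2 * q.2 0 * q.2 1)) + q.1 * q.2 1,
    (1 - q.1) * -q.2 1]

theorem contDiff_torusKnotHomotopy : ContDiff ℝ (⊤ : ℕ∞) torusKnotHomotopy := by
  rw [contDiff_euclidean]
  intro i
  fin_cases i <;> simp only [torusKnotHomotopy] <;> simp <;> fun_prop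

theorem S1.sq_add_sq (p : S1) : (p : E2) 0 ^ 2 + (p : E2) 1 ^ 2 = 1 := by
  have h := EuclideanSpace.norm_sq_eq (p : E2)
  rw [norm_eq_of_mem_sphere] at h
  simpa [Fin.sum_univ_two] using h.symm

theorem torusKnotHomotopy_injective (t : ℝ) :
    Function.Injective fun p : S1 => torusKnotHomotopy (t, p) := by
  intro p q hpq
  have hp := S1.sq_add_sq p
  have hq := S1.sq_add_sq q
  have h0 := congrArg (fun v : E3 => v 0) hpq
  have h1 := congrArg (fun v : E3 => v 1) hpq
  have h2 := congrArg (fun v : E3 => v 2) hpq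
  simp [torusKnotHomotopy] at h0 h1 h2
  suffices h : (p : E2) 0 = (q : E2) 0 ∧ (p : E2) 1 = (q : E2) 1 by
    ext i
    fin_cases i
    exacts [h.1, h.2]
  generalize (p : E2) 0 = x, (p : E2) 1 = y, (q : E2) 0 = x', (q : E2) 1 = y' at *
  have hs : √2 ≠ 0 := by positivity
  obtain rfl | ht := eq_or_ne t 1
  · simp at h0 h1
    exact ⟨h0, h1⟩
  have ht' : 1 - t ≠ 0 := sub_ne_zero.mpr ht.symm
  have hy : y = y' := by grind
  subst hy
  refine ⟨?_, rfl⟩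
  obtain hx | hx : x = x' ∨ x = -x' := sq_eq_sq_iff_eq_or_eq_neg.mp (by linarith)
  · exact hx
  have hxy : (1 - t) * √2 * (x' * y) = 0 := by
    subst hx
    linear_combination (-1 / 4) * h1
  obtain hx' | rfl : x' = 0 ∨ y = 0 := by simpa [ht', hs] using hxy
  · simp [hx, hx']
  · subst hx
    have : x' = 0 := by linear_combination (-1 / 2) * h0 - (1 - t) * x' * hq
    simp [this]

theorem eq_zero_of_fderiv_torusKnotHomotopy_eq_zero (t : ℝ) (p : S1) (v : E2)
    (hpv : (p : E2) 0 * v 0 + (p : E2) 1 * v 1 = 0)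
    (hv : fderiv ℝ (fun z : E2 => torusKnotHomotopy (t, z)) p v = 0) : v = 0 := by
  have hp := S1.sq_add_sq p
  have hd : DifferentiableAt ℝ (fun z : E2 => torusKnotHomotopy (t, z)) p :=
    ((contDiff_torusKnotHomotopy.comp (contDiff_prodMk_right t)).differentiable
      (by simp)).differentiableAt
  -- Read off the derivative coordinatewise along the line through `p` in direction `v`.
  have hline : HasDerivAt (fun s : ℝ => (p : E2) + s • v) v 0 := by
    simpa using ((hasDerivAt_id (0 : ℝ)).smul_const v).const_add (p : E2)
  have hcoord (i : Fin 2) : HasDerivAt (fun s : ℝ => ((p : E2) + s • v) i) (v i) 0 :=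
    (EuclideanSpace.proj (𝕜 := ℝ) i).hasFDerivAt.comp_hasDerivAt (0 : ℝ) hline
  have hcurve : HasDerivAt (fun s : ℝ => torusKnotHomotopy (t, (p : E2) + s • v)) 0 0 := by
    rw [← hv]
    exact HasFDerivAt.comp_hasDerivAt_of_eq (0 : ℝ) hd.hasFDerivAt hline (by simp)
  have hcurve_coord (i : Fin 3) :
      HasDerivAt (fun s : ℝ => torusKnotHomotopy (t, (p : E2) + s • v) i) 0 0 :=
    (EuclideanSpace.proj (𝕜 := ℝ) i).hasFDerivAt.comp_hasDerivAt (0 : ℝ) hcurve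
  have hx := hcoord 0
  have hy := hcoord 1
  have e0 := (hcurve_coord 0).unique
    ((((hx.const_add √2).mul ((hx.pow 2).sub (hy.pow 2))).const_mul (1 - t)).add (hx.const_mul t))
  have e1 := (hcurve_coord 1).unique
    ((((hx.const_add √2).mul ((hx.const_mul 2).mul hy)).const_mul (1 - t)).add (hy.const_mul t))
  have e2 := (hcurve_coord 2).unique (hy.neg.const_mul (1 - t))
  simp at e0 e1 e2
  suffices h : v 0 = 0 ∧ v 1 = 0 by
    ext i
    fin_cases i
    exacts [h.1, h.2]
  generalize (p : E2) 0 = x, (p : E2) 1 = y, v 0 = a, v 1 = b at *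
  have hs : √2 ≠ 0 := by positivity
  obtain rfl | ht := eq_or_ne t 1
  · simp at e0 e1
    exact ⟨e0.symm, e1.symm⟩
  have ht' : 1 - t ≠ 0 := sub_ne_zero.mpr ht.symm
  have hb : b = 0 := by grind
  subst hb
  refine ⟨?_, rfl⟩
  obtain rfl | ha : x = 0 ∨ a = 0 := by simpa using hpv
  · have hy0 : y ≠ 0 := by
      rintro rfl
      simp at hp
    have : (1 - t) * √2 * y * a = 0 := by linear_combination (-1 / 2) * e1
    simpa [ht', hs, hy0] using this
  · exact ha

theorem isCircleImmersion_torusKnotHomotopy (t : ℝ) :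
    IsCircleImmersion fun p : S1 => torusKnotHomotopy (t, p) := by
  have : Fact (Module.finrank ℝ E2 = 1 + 1) := ⟨by simp⟩
  have hF : ContDiff ℝ (⊤ : ℕ∞) fun z : E2 => torusKnotHomotopy (t, z) :=
    contDiff_torusKnotHomotopy.comp (contDiff_prodMk_right t)
  have hcoe : ContMDiff (𝓡 1) 𝓘(ℝ, E2) (⊤ : ℕ∞) ((↑) : S1 → E2) := contMDiff_coe_sphere
  refine ⟨hF.contMDiff.comp hcoe, fun p => ?_⟩
  have hcomp : mfderiv (𝓡 1) 𝓘(ℝ, E3) (fun p : S1 => torusKnotHomotopy (t, p)) p =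
      (fderiv ℝ (fun z : E2 => torusKnotHomotopy (t, z)) p).comp
        (mfderiv (𝓡 1) 𝓘(ℝ, E2) ((↑) : S1 → E2) p) := by
    rw [← mfderiv_eq_fderiv]
    exact mfderiv_comp p (hF.contMDiff.mdifferentiable (by simp) _)
      (hcoe.mdifferentiable (by simp) p)
  rw [hcomp]
  refine (injective_iff_map_eq_zero _).mpr fun w hw => ?_
  refine (injective_iff_map_eq_zero _).mp (injective_mvfderiv_subtypeVal_sphere (n := 1) p) w ?_
  have hmem : mvfderiv (𝓡 1) ((↑) : S1 → E2) p w ∈ (ℝ ∙ (p : E2))ᗮ := by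
    rw [← range_mvfderiv_subtypeVal (n := 1) p]
    exact ⟨w, rfl⟩
  have horth := Submodule.mem_orthogonal_singleton_iff_inner_right.mp hmem
  refine eq_zero_of_fderiv_torusKnotHomotopy_eq_zero t p _ ?_ hw
  rw [PiLp.inner_apply] at horth
  simpa [Fin.sum_univ_two, mul_comm] using horth

/-- The (2,−1) torus knot is unknotted: there is a smooth map `H : ℝ × S¹ → ℝ³`, with
`H (t, ·)` an injective smooth immersion for every `t`, deforming the (2,−1) torus knot
`(x, y) ↦ ((√2 + x)(x² − y²), (√2 + x)(2xy), −y)` (i.e. `(cos s, sin s) ↦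
((√2 + cos s)cos 2s, (√2 + cos s)sin 2s, −sin s)`) to the round unit circle
`(x, y) ↦ (x, y, 0)` in the xy-plane. -/
theorem torus_knot_two_neg_one_unknotted :
    ∃ H : ℝ × S1 → E3,
      ContMDiff ((𝓘(ℝ, ℝ)).prod (𝓡 1)) 𝓘(ℝ, E3) (⊤ : ℕ∞) H ∧
      (∀ t : ℝ, IsCircleImmersion (fun x => H (t, x)) ∧
        Function.Injective (fun x => H (t, x))) ∧
      (∀ p : S1, H (0, p) =
        ![(Real.sqrt 2 + (p : E2) 0) * ((p : E2) 0 ^ 2 - (p : E2) 1 ^ 2),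
          (Real.sqrt 2 + (p : E2) 0) * (2 * (p : E2) 0 * (p : E2) 1),
          -(p : E2) 1]) ∧
      (∀ p : S1, H (1, p) = ![(p : E2) 0, (p : E2) 1, 0]) := by
  have : Fact (Module.finrank ℝ E2 = 1 + 1) := ⟨by simp⟩
  refine ⟨fun q => torusKnotHomotopy (q.1, q.2), ?_,
    fun t => ⟨isCircleImmersion_torusKnotHomotopy t, torusKnotHomotopy_injective t⟩, ?_, ?_⟩
  · exact contDiff_torusKnotHomotopy.contMDiff.comp
      (contMDiff_fst.prodMk_space (contMDiff_coe_sphere.comp contMDiff_snd))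
  · intro p
    simp [torusKnotHomotopy]
  · intro p
    simp [torusKnotHomotopy]
end
end
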